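/- arXiv:2603.28165 — 6 statements merged into one kernel-verified Lean document; each statement's English description precedes it below -/
import Mathlib

section
/- Let X be a spectral space. The following are equivalent: (i) qcop(X) is a Heyting algebra; (ii) the closure of every constructible subset of X is constructible; (iii) every closed constructible subspace of X is a PC-space; (iv) for every subset S of X, the closure of S in the inverse topology equals the patch closure of the down-set ↓S. -/
open Set Topology

namespace PCF

variable {X : Type*}

/-- The compact open subsets of a topological space. -/
def qcop (t : TopologicalSpace X) : Set (Set X) :=
  {U | @IsOpen X t U ∧ @IsCompact X t U}

/-- The complements of the compact open subsets. -/
def qccl (t : TopologicalSpace X) : Set (Set X) :=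
  {C | ∃ U ∈ qcop t, C = Uᶜ}

/-- The Boolean algebra of subsets generated by the compact open sets:
the constructible sets. -/
def Constructible (t : TopologicalSpace X) : Set (Set X) :=
  ⋂₀ {B : Set (Set X) | qcop t ⊆ B ∧ (∀ s ∈ B, sᶜ ∈ B) ∧
        (∀ s ∈ B, ∀ u ∈ B, s ∪ u ∈ B) ∧ (∅ : Set X) ∈ B}

/-- The patch topology: generated by the compact open sets together with their
complements (equivalently, by the constructible sets). -/
def patchTop (t : TopologicalSpace X) : TopologicalSpace X :=
  TopologicalSpace.generateFrom (qcop t ∪ qccl t)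

/-- The inverse topology, with the complements of compact opens as a basis of opens. -/
def invTop (t : TopologicalSpace X) : TopologicalSpace X :=
  TopologicalSpace.generateFrom (qccl t)

/-- The specialization order: `x ≤ y` iff `y` is in the closure of `{x}`. -/
def specLE (t : TopologicalSpace X) (x y : X) : Prop := y ∈ @closure X t {x}

/-- Minimal points for the specialization order. -/
def minPts (t : TopologicalSpace X) : Set X := {x | ∀ y, specLE t y x → y = x}

/-- Maximal points for the specialization order. -/
def maxPts (t : TopologicalSpace X) : Set X := {x | ∀ y, specLE t x y → y = x}

/-- Minimal points of a subset `S`, for the induced specialization order. -/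
def minPtsIn (t : TopologicalSpace X) (S : Set X) : Set X :=
  {x | x ∈ S ∧ ∀ y ∈ S, specLE t y x → y = x}

/-- Maximal points of a subset `S`, for the induced specialization order. -/
def maxPtsIn (t : TopologicalSpace X) (S : Set X) : Set X :=
  {x | x ∈ S ∧ ∀ y ∈ S, specLE t x y → y = x}

/-- The down-set (set of generalizations) generated by `S`. -/
def downset (t : TopologicalSpace X) (S : Set X) : Set X :=
  {x | ∃ s ∈ S, specLE t x s}

/-- The up-set (set of specializations) generated by `S`. -/
def upset (t : TopologicalSpace X) (S : Set X) : Set X :=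
  {x | ∃ s ∈ S, specLE t s x}

/-- A topology is spectral if the space is compact, sober (quasi-sober and T0),
the compact opens form a basis, and the compact opens are closed under
finite intersections. -/
def IsSpectral (t : TopologicalSpace X) : Prop :=
  @CompactSpace X t ∧ @QuasiSober X t ∧ @T0Space X t ∧
  @TopologicalSpace.IsTopologicalBasis X t (qcop t) ∧
  ∀ U ∈ qcop t, ∀ V ∈ qcop t, U ∩ V ∈ qcop t

/-- A Boolean space: compact, Hausdorff and zero-dimensional. -/
def IsBooleanSpace (t : TopologicalSpace X) : Prop :=
  @CompactSpace X t ∧ @T2Space X t ∧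
  @TopologicalSpace.IsTopologicalBasis X t {U | @IsClopen X t U}

/-- `V` is the pseudocomplement of `U` in the lattice of sets `L` (ordered by
inclusion, with meet given by intersection and bottom element `∅`): `V` is the
largest element of `L` disjoint from `U`. -/
def IsPseudoCompl (L : Set (Set X)) (U V : Set X) : Prop :=
  V ∈ L ∧ U ∩ V = ∅ ∧ ∀ W ∈ L, U ∩ W = ∅ → W ⊆ V

/-- The lattice of sets `L` is pseudocomplemented: every element has a
pseudocomplement. -/
def Pseudocomplemented (L : Set (Set X)) : Prop :=
  ∀ U ∈ L, ∃ V, IsPseudoCompl L U V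

/-- The lattice of sets `L` is a Stone algebra: it is pseudocomplemented and
`U* ∪ U** = ⊤` for every `U`. -/
def StoneAlgebra (L : Set (Set X)) : Prop :=
  Pseudocomplemented L ∧
  ∀ U ∈ L, ∀ V W : Set X, IsPseudoCompl L U V → IsPseudoCompl L V W → V ∪ W = univ

/-- The lattice of sets `L` is a Heyting algebra: for all `U, V ∈ L` there is a
largest `W ∈ L` with `U ∩ W ⊆ V`. -/
def HeytingAlg (L : Set (Set X)) : Prop :=
  ∀ U ∈ L, ∀ V ∈ L, ∃ W ∈ L, U ∩ W ⊆ V ∧ ∀ W' ∈ L, U ∩ W' ⊆ V → W' ⊆ W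

/-- A PC-space: the lattice of compact open sets is pseudocomplemented. -/
def IsPCSpace (t : TopologicalSpace X) : Prop := Pseudocomplemented (qcop t)

/-- An Esakia space: the closure of every constructible set is constructible. -/
def IsEsakia (t : TopologicalSpace X) : Prop :=
  ∀ S ∈ Constructible t, @closure X t S ∈ Constructible t

/-- A spectral root system: the closure of every point is a specialization chain. -/
def IsRootSystem (t : TopologicalSpace X) : Prop :=
  ∀ x : X, IsChain (specLE t) (@closure X t {x})

/-- A spectral forest: the inverse space is a spectral root system. -/
def IsForest (t : TopologicalSpace X) : Prop := IsRootSystem (invTop t)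

/-- A stranded space: the specialization poset is a disjoint union of chains, i.e.
the set of points comparable with any fixed point is a chain. -/
def Stranded (t : TopologicalSpace X) : Prop :=
  ∀ x : X, IsChain (specLE t) {y | specLE t x y ∨ specLE t y x}

end PCF

open PCF

section Rings

variable (T : Type*) [TopologicalSpace T]

/-- The zero set of a continuous real-valued function. -/
def zeroSet (f : ContinuousMap T ℝ) : Set T := {t | f t = 0}

/-- The lattice of cozero sets of a topological space. -/
def Coz : Set (Set T) := {U | ∃ f : ContinuousMap T ℝ, U = {t | f t ≠ 0}}

/-- A z-ideal of the ring `C(T)` of continuous real-valued functions. -/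
def IsZIdeal (I : Ideal (ContinuousMap T ℝ)) : Prop :=
  ∀ f ∈ I, ∀ g : ContinuousMap T ℝ, zeroSet T f ⊆ zeroSet T g → g ∈ I

/-- The prime z-ideals, as a subset of the prime spectrum of `C(T)`. -/
def zSpec : Set (PrimeSpectrum (ContinuousMap T ℝ)) :=
  {p | IsZIdeal T p.asIdeal}

/-- A space is basically disconnected if the closure of every cozero set is open. -/
def BasicallyDisconnected : Prop :=
  ∀ f : ContinuousMap T ℝ, IsOpen (closure {t | f t ≠ 0})

/-- The Zariski topology on the prime spectrum of `C(T)`. -/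
def specTop : TopologicalSpace (PrimeSpectrum (ContinuousMap T ℝ)) := inferInstance

/-- The subspace topology on the set of prime z-ideals. -/
def zTop : TopologicalSpace ↥(zSpec T) := inferInstance

end Rings

/-- The subspace topology on a subset. -/
def subTop {Y : Type*} [TopologicalSpace Y] (X : Set Y) : TopologicalSpace ↥X :=
  inferInstance

namespace PCF

section Patch

variable {X : Type*} [t : TopologicalSpace X]

theorem constructible_of_mem_qcop {U : Set X} (hU : U ∈ qcop t) : U ∈ Constructible t :=
  fun _ hB => hB.1 hU

theorem constructible_compl {S : Set X} (hS : S ∈ Constructible t) : Sᶜ ∈ Constructible t :=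
  fun B hB => hB.2.1 S (hS B hB)

theorem isOpen_patch_of_mem_qcop {U : Set X} (hU : U ∈ qcop t) : IsOpen[patchTop t] U :=
  TopologicalSpace.isOpen_generateFrom_of_mem (Or.inl hU)

theorem isOpen_patch_compl_of_mem_qcop {U : Set X} (hU : U ∈ qcop t) :
    IsOpen[patchTop t] Uᶜ :=
  TopologicalSpace.isOpen_generateFrom_of_mem (Or.inr ⟨U, hU, rfl⟩)

theorem isOpen_inv_compl_of_mem_qcop {U : Set X} (hU : U ∈ qcop t) : IsOpen[invTop t] Uᶜ :=
  TopologicalSpace.isOpen_generateFrom_of_mem ⟨U, hU, rfl⟩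

theorem patchTop_le_invTop : patchTop t ≤ invTop t :=
  TopologicalSpace.generateFrom_anti subset_union_right

theorem isClopen_patch_of_constructible {S : Set X} (hS : S ∈ Constructible t) :
    @IsClopen X (patchTop t) S := by
  refine hS {S | @IsClopen X (patchTop t) S} ⟨fun U hU => ⟨?_, isOpen_patch_of_mem_qcop hU⟩,
    fun _ => @IsClopen.compl X (patchTop t) _, fun _ h _ => @IsClopen.union X (patchTop t) _ _ h,
    @isClopen_empty X (patchTop t)⟩
  exact (@isOpen_compl_iff X _ (patchTop t)).1 (isOpen_patch_compl_of_mem_qcop hU)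

theorem specLE_refl (x : X) : specLE t x x := subset_closure rfl

theorem mem_closure_inv_of_specLE {S : Set X} {x y : X} (hxy : specLE t x y)
    (hy : y ∈ closure[invTop t] S) : x ∈ closure[invTop t] S := by
  have h : invTop t = TopologicalSpace.generateFrom (qccl t) := rfl
  have hsp : @Specializes X (invTop t) y x := by
    rw [@specializes_iff_pure X (invTop t), h, TopologicalSpace.nhds_generateFrom]
    refine le_iInf₂ fun s hs => ?_
    obtain ⟨hxs, U, hU, rfl⟩ := hs
    have hyU : y ∈ Uᶜ := closure_minimal (singleton_subset_iff.2 hxs) hU.1.isClosed_compl hxy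
    simpa using hyU
  exact @Specializes.mem_closed X (invTop t) _ _ _ hsp (@isClosed_closure X (invTop t) S) hy

theorem closure_patch_downset_subset (S : Set X) :
    closure[patchTop t] (downset t S) ⊆ closure[invTop t] S := by
  refine @closure_minimal X (patchTop t) _ _ ?_
    ((@isClosed_closure X (invTop t) S).mono patchTop_le_invTop)
  rintro x ⟨s, hs, hxs⟩
  exact mem_closure_inv_of_specLE hxs (@subset_closure X (invTop t) S s hs)

theorem downset_eq_of_isOpen {U : Set X} (hU : IsOpen U) : downset t U = U := by
  refine Subset.antisymm ?_ fun x hx => ⟨x, hx, specLE_refl x⟩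
  rintro x ⟨s, hs, hxs⟩
  obtain ⟨y, hy, rfl⟩ := mem_closure_iff.1 hxs U hU hs
  exact hy

theorem isTopologicalBasis_patch (hX : IsSpectral t) :
    @TopologicalSpace.IsTopologicalBasis X (patchTop t)
      {S | ∃ U ∈ qcop t, ∃ V ∈ qcop t, S = U \ V} := by
  obtain ⟨hc, -, -, -, hinter⟩ := hX
  have huniv : univ ∈ qcop t := ⟨isOpen_univ, isCompact_univ⟩
  have hempty : ∅ ∈ qcop t := ⟨isOpen_empty, isCompact_empty⟩
  refine @TopologicalSpace.isTopologicalBasis_of_isOpen_of_nhds X (patchTop t) _ ?_ ?_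
  · rintro _ ⟨U, hU, V, hV, rfl⟩
    exact @IsOpen.inter X (patchTop t) _ _ (isOpen_patch_of_mem_qcop hU)
      (isOpen_patch_compl_of_mem_qcop hV)
  · intro x O hx hO
    induction hO with
    | basic s hs =>
      refine ⟨s, ?_, hx, subset_rfl⟩
      rcases hs with hs | ⟨V, hV, rfl⟩
      · exact ⟨s, hs, ∅, hempty, by simp⟩
      · exact ⟨univ, huniv, V, hV, by simp [compl_eq_univ_sdiff]⟩
    | univ => exact ⟨univ, ⟨univ, huniv, ∅, hempty, by simp⟩, hx, subset_rfl⟩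
    | inter s u _ _ ihs ihu =>
      obtain ⟨_, ⟨U, hU, V, hV, rfl⟩, hxs, hs⟩ := ihs hx.1
      obtain ⟨_, ⟨U', hU', V', hV', rfl⟩, hxu, hu⟩ := ihu hx.2
      refine ⟨(U ∩ U') \ (V ∪ V'), ⟨_, hinter U hU U' hU', _,
        ⟨hV.1.union hV'.1, hV.2.union hV'.2⟩, rfl⟩, ?_, fun y hy => ⟨hs ?_, hu ?_⟩⟩
      · exact ⟨⟨hxs.1, hxu.1⟩, fun h => h.elim hxs.2 hxu.2⟩
      · exact ⟨hy.1.1, fun h => hy.2 (Or.inl h)⟩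
      · exact ⟨hy.1.2, fun h => hy.2 (Or.inr h)⟩
    | sUnion 𝒮 _ ih =>
      obtain ⟨s, hs, hxs⟩ := hx
      obtain ⟨v, hv, hxv, hvs⟩ := ih s hs hxs
      exact ⟨v, hv, hxv, hvs.trans (subset_sUnion_of_mem hs)⟩

theorem patchTop_eq_constructibleTopology : patchTop t = constructibleTopology X := by
  refine congrArg TopologicalSpace.generateFrom (congrArg (qcop t ∪ ·) ?_)
  ext C
  constructor
  · rintro ⟨U, hU, rfl⟩
    exact ⟨hU.1.isClosed_compl, by simpa using hU.2⟩
  · exact fun hC => ⟨Cᶜ, ⟨hC.1.isOpen_compl, hC.2⟩, by simp⟩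

theorem compactSpace_patch (hX : IsSpectral t) : @CompactSpace X (patchTop t) := by
  obtain ⟨hc, hq, -, hb, hinter⟩ := hX
  have : PrespectralSpace X := ⟨hb⟩
  have : QuasiSeparatedSpace X :=
    ⟨fun U V hU hUc hV hVc => (hinter U ⟨hU, hUc⟩ V ⟨hV, hVc⟩).2⟩
  rw [patchTop_eq_constructibleTopology]
  exact @Function.Surjective.compactSpace (WithConstructibleTopology X) X _
    (constructibleTopology X) _ (WithTopology.continuous_ofTopology _) inferInstance
    (WithTopology.ofTopology_surjective _)

theorem patchTop_le (hX : IsSpectral t) : patchTop t ≤ t := by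
  exact (TopologicalSpace.generateFrom_anti subset_union_left).trans_eq
    hX.2.2.2.1.eq_generateFrom.symm

theorem mem_qcop_of_isClosed_patch (hX : IsSpectral t) {U : Set X} (hU : IsOpen U)
    (hUp : IsClosed[patchTop t] U) : U ∈ qcop t := by
  refine ⟨hU, ?_⟩
  have hc : @IsCompact X (patchTop t) U :=
    @IsClosed.isCompact X (patchTop t) _ (compactSpace_patch hX) hUp
  simpa using @IsCompact.image X X (patchTop t) t U id hc (continuous_id_of_le (patchTop_le hX))

/-- The closure of a patch-closed set consists of the specializations of its points. -/
theorem exists_specLE_of_mem_closure (hX : IsSpectral t) {S : Set X}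
    (hS : IsClosed[patchTop t] S) {x : X} (hx : x ∈ closure S) : ∃ s ∈ S, specLE t s x := by
  have hb := hX.2.2.2.1
  have hinter := hX.2.2.2.2
  have hcs := compactSpace_patch hX
  have hc : @IsCompact X (patchTop t) S := @IsClosed.isCompact X (patchTop t) _ hcs hS
  have hclosed : ∀ U : {U // U ∈ qcop t ∧ x ∈ U}, IsClosed[patchTop t] (U : Set X) := fun U =>
    (isClopen_patch_of_constructible (constructible_of_mem_qcop U.2.1)).1
  obtain ⟨s, hs, hsU⟩ : (S ∩ ⋂ U : {U // U ∈ qcop t ∧ x ∈ U}, (U : Set X)).Nonempty := by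
    refine @IsCompact.inter_iInter_nonempty X (patchTop t) _ _ hc _ hclosed fun F => ?_
    have hopen : IsOpen (⋂ U ∈ F, (U : Set X)) := isOpen_biInter_finset fun U _ => U.2.1.1
    rw [inter_comm]
    exact mem_closure_iff.1 hx _ hopen (mem_iInter₂.2 fun U _ => U.2.2)
  refine ⟨s, hs, hb.mem_closure_iff.2 fun U hU hxU => ⟨s, ?_, rfl⟩⟩
  exact mem_iInter.1 hsU ⟨U, hU, hxU⟩

/-- A relative pseudocomplement of `U` in `V` is the exterior of `U \ V`. -/
theorem compl_eq_closure_sdiff (hX : IsSpectral t) {U V W : Set X} (hW : W ∈ qcop t)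
    (hUW : U ∩ W ⊆ V) (hmax : ∀ W' ∈ qcop t, U ∩ W' ⊆ V → W' ⊆ W) :
    Wᶜ = closure (U \ V) := by
  refine Subset.antisymm (fun x hx => ?_) (closure_minimal ?_ hW.1.isClosed_compl)
  · by_contra hxc
    obtain ⟨W', hW', hxW', hsub⟩ :=
      hX.2.2.2.1.exists_subset_of_mem_open hxc isClosed_closure.isOpen_compl
    refine hx (hmax W' hW' (fun y hy => ?_) hxW')
    by_contra hyV
    exact hsub hy.2 (subset_closure ⟨hy.1, hyV⟩)
  · exact fun y hy hyW => hy.2 (hUW ⟨hy.1, hyW⟩)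

theorem HeytingAlg.closure_inv_eq (hX : IsSpectral t) (h : HeytingAlg (qcop t)) (S : Set X) :
    closure[invTop t] S = closure[patchTop t] (downset t S) := by
  refine Subset.antisymm (fun x hx => ?_) (closure_patch_downset_subset S)
  rw [@TopologicalSpace.IsTopologicalBasis.mem_closure_iff X (patchTop t) _
    (isTopologicalBasis_patch hX)]
  rintro _ ⟨U, hU, V, hV, rfl⟩ hxUV
  obtain ⟨W, hW, hUW, hmax⟩ := h U hU V hV
  have hWc := compl_eq_closure_sdiff hX hW hUW hmax
  obtain ⟨s, hsW, hs⟩ := (@mem_closure_iff X (invTop t) _ _).1 hx Wᶜ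
    (isOpen_inv_compl_of_mem_qcop hW) (hWc ▸ subset_closure hxUV)
  have hclosed : IsClosed[patchTop t] (U \ V) := @IsClosed.inter X _ _ (patchTop t)
    (isClopen_patch_of_constructible (constructible_of_mem_qcop hU)).1
    (isClopen_patch_of_constructible (constructible_compl (constructible_of_mem_qcop hV))).1
  obtain ⟨k, hk, hks⟩ := exists_specLE_of_mem_closure hX hclosed (hWc ▸ hsW)
  exact ⟨k, hk, s, hs, hks⟩

theorem closure_constructible_of_closure_inv_eq (hX : IsSpectral t)
    (h : ∀ S : Set X, closure[invTop t] S = closure[patchTop t] (downset t S))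
    {S : Set X} (hS : S ∈ Constructible t) : closure S ∈ Constructible t := by
  have hSp := isClopen_patch_of_constructible hS
  have hopen : IsOpen (closure S)ᶜ := isClosed_closure.isOpen_compl
  have hD := h (closure S)ᶜ
  rw [downset_eq_of_isOpen hopen] at hD
  have hdisj : closure[patchTop t] (closure S)ᶜ ⊆ Sᶜ :=
    @closure_minimal X (patchTop t) _ _ (compl_subset_compl.2 subset_closure)
      (@IsOpen.isClosed_compl X (patchTop t) _ hSp.2)
  have hsub : closure[patchTop t] (closure S)ᶜ ⊆ (closure S)ᶜ := by
    intro y hy hyS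
    obtain ⟨s, hs, hsy⟩ := exists_specLE_of_mem_closure hX hSp.1 hyS
    exact hdisj (hD ▸ mem_closure_inv_of_specLE hsy (hD ▸ hy)) hs
  have hmem : (closure S)ᶜ ∈ qcop t := mem_qcop_of_isClosed_patch hX hopen
    ((@closure_subset_iff_isClosed X (patchTop t) _).1 hsub)
  simpa using constructible_compl (constructible_of_mem_qcop hmem)

theorem heytingAlg_of_closure_constructible (hX : IsSpectral t)
    (h : ∀ S ∈ Constructible t, closure S ∈ Constructible t) : HeytingAlg (qcop t) := by
  intro U hU V hV
  have hUV : U \ V ∈ Constructible t := by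
    intro B hB
    have := hB.2.1 _ (hB.2.2.1 _ (hB.2.1 _ (hB.1 hU)) _ (hB.1 hV))
    rwa [compl_union, compl_compl] at this
  have hmem : (closure (U \ V))ᶜ ∈ qcop t :=
    mem_qcop_of_isClosed_patch hX isClosed_closure.isOpen_compl
      (isClopen_patch_of_constructible (constructible_compl (h _ hUV))).1
  refine ⟨_, hmem, fun y hy => ?_, fun W' hW' hUW' => ?_⟩
  · by_contra hyV
    exact hy.2 (subset_closure ⟨hy.1, hyV⟩)
  · rw [subset_compl_comm]
    exact closure_minimal (fun y hy hyW => hy.2 (hUW' ⟨hy.1, hyW⟩)) hW'.1.isClosed_compl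

theorem preimage_val_mem_qcop {C W : Set X} (hC : IsClosed C) (hW : W ∈ qcop t) :
    (Subtype.val ⁻¹' W : Set C) ∈ qcop (subTop C) :=
  ⟨hW.1.preimage continuous_subtype_val, hC.isClosedEmbedding_subtypeVal.isCompact_preimage hW.2⟩

theorem image_val_union_compl_mem_qcop {C : Set X} (hC : Cᶜ ∈ qcop t) {W : Set C}
    (hW : W ∈ qcop (subTop C)) : Subtype.val '' W ∪ Cᶜ ∈ qcop t := by
  refine ⟨?_, (IsCompact.image hW.2 continuous_subtype_val).union hC.2⟩
  obtain ⟨O, hO, rfl⟩ := isOpen_induced_iff.1 hW.1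
  convert hO.union hC.1 using 1
  ext y
  by_cases hy : y ∈ C <;> simp [hy]

theorem HeytingAlg.isPCSpace_of_isClosed (h : HeytingAlg (qcop t)) {C : Set X} (hC : IsClosed C)
    (hCc : Cᶜ ∈ qcop t) : IsPCSpace (subTop C) := by
  intro U hU
  obtain ⟨W, hW, hUW, hmax⟩ := h _ (image_val_union_compl_mem_qcop hCc hU) _ hCc
  refine ⟨Subtype.val ⁻¹' W, preimage_val_mem_qcop hC hW, ?_, fun W' hW' hUW' y hy => ?_⟩
  · refine eq_empty_of_forall_notMem fun y hy => ?_
    exact hUW ⟨Or.inl ⟨y, hy.1, rfl⟩, hy.2⟩ y.2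
  · refine hmax _ (image_val_union_compl_mem_qcop hCc hW') ?_ (Or.inl ⟨y, hy, rfl⟩)
    rw [← inter_union_distrib_right, ← image_inter Subtype.val_injective, hUW', image_empty,
      empty_union]

theorem heytingAlg_of_isPCSpace
    (h : ∀ C ∈ Constructible t, IsClosed C → IsPCSpace (subTop C)) : HeytingAlg (qcop t) := by
  intro U hU V hV
  have hC : IsClosed Vᶜ := hV.1.isClosed_compl
  obtain ⟨W, hW, hUW, hmax⟩ := h Vᶜ (constructible_compl (constructible_of_mem_qcop hV)) hC _
    (preimage_val_mem_qcop hC hU)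
  refine ⟨_, image_val_union_compl_mem_qcop (by rwa [compl_compl]) hW, ?_,
    fun W' hW' hUW' y hy => ?_⟩
  · rintro y ⟨hyU, ⟨y, hyW, rfl⟩ | hyV⟩
    · exact (eq_empty_iff_forall_notMem.1 hUW y ⟨hyU, hyW⟩).elim
    · simpa using hyV
  · by_cases hyV : y ∈ V
    · exact Or.inr (by simpa using hyV)
    · refine Or.inl ⟨⟨y, hyV⟩, hmax _ (preimage_val_mem_qcop hC hW') ?_ hy, rfl⟩
      exact eq_empty_of_forall_notMem fun z hz => z.2 (hUW' hz)

end Patch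

end PCF

/-- For a spectral space `X`, TFAE: (i) `qcop X` is a Heyting algebra;
(ii) the closure of every constructible set is constructible; (iii) every closed
constructible subspace of `X` is a PC-space; (iv) for every `S ⊆ X`, the closure of `S`
in the inverse topology equals the patch closure of `↓S`. -/
theorem statement_9 {X : Type*} [t : TopologicalSpace X] (hX : IsSpectral t) :
    List.TFAE
      [ HeytingAlg (qcop t),
        ∀ S ∈ Constructible t, closure S ∈ Constructible t,
        ∀ C ∈ Constructible t, IsClosed C → IsPCSpace (subTop C),
        ∀ S : Set X, @closure X (invTop t) S = @closure X (patchTop t) (downset t S) ] := by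
  tfae_have 1 → 3 := fun h C hC hCc => h.isPCSpace_of_isClosed hCc
    (mem_qcop_of_isClosed_patch hX hCc.isOpen_compl
      (isClopen_patch_of_constructible (constructible_compl hC)).1)
  tfae_have 3 → 1 := heytingAlg_of_isPCSpace
  tfae_have 1 → 4 := HeytingAlg.closure_inv_eq hX
  tfae_have 4 → 2 := fun h _ hS => closure_constructible_of_closure_inv_eq hX h hS
  tfae_have 2 → 1 := heytingAlg_of_closure_constructible hX
  tfae_finish
end

section
/- Let T be a completely regular Hausdorff space, X = Spec C(T) and Z = zSpec C(T). The following are equivalent: (i) T is a P-space (i.e. X is Boolean); (ii) Z is Boolean; (iii) qccl(Z) is a Stone algebra; (iv) the inverse space of Z is an Esakia space (hence qccl(Z) is a Heyting algebra); (v) the inverse space of Z is a PC-space (hence qccl(Z) is pseudocomplemented); (vi) Z^max is patch closed; (vii) for every U ∈ qcop(Z) the set U^max is patch closed; (viii) for all U, V ∈ qcop(Z) the set U^max ∩ V is compact; (ix) for every C ∈ qccl(Z) the set ↓C is open (equivalently, patch open) in Z; (x) for every C ∈ qccl(Z) the set ↓C is clopen in Z. Furthermore, these conditions are also equivalent to each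 of the conditions (iii)–(x) formulated for X instead of Z. -/
open Set Topology

open PCF

section SpectralModels

/-- The set of points of `Y` whose prime ideal (via `φ`) does not contain `f`. -/
def nonvanishing {T Y : Type*} [TopologicalSpace T]
    (φ : Y → PrimeSpectrum (ContinuousMap T ℝ)) (f : ContinuousMap T ℝ) : Set Y :=
  {y | f ∉ (φ y).asIdeal}

/-- A space `Y` identified via `φ` with a subspace of the prime spectrum of `C(T)` which
is closed under ultrafilter limits and contains all maximal ideals. -/
structure IsSpectralModel {T Y : Type*} [TopologicalSpace T] (t : TopologicalSpace Y)
    (φ : Y → PrimeSpectrum (ContinuousMap T ℝ)) : Prop where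
  injective : Function.Injective φ
  isTopologicalBasis : @TopologicalSpace.IsTopologicalBasis Y t (range (nonvanishing φ))
  exists_limit : ∀ F : Ultrafilter Y, ∃ y, ∀ f,
    f ∈ (φ y).asIdeal ↔ ∀ᶠ x in F, f ∈ (φ x).asIdeal
  exists_eq_of_isMaximal : ∀ I : Ideal (ContinuousMap T ℝ), I.IsMaximal →
    ∃ y, (φ y).asIdeal = I

variable {T Y : Type*} [TopologicalSpace T]

theorem exists_eq_zero_of_mem {I : Ideal (ContinuousMap T ℝ)} (hI : I ≠ ⊤)
    {f : ContinuousMap T ℝ} (hf : f ∈ I) : ∃ x, f x = 0 := by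
  by_contra! h
  exact hI (I.eq_top_of_isUnit_mem hf (ContinuousMap.isUnit_iff_forall_ne_zero f |>.2 h))

theorem isZIdeal_of_isMaximal {I : Ideal (ContinuousMap T ℝ)} (hI : I.IsMaximal) :
    IsZIdeal T I := by
  intro f hf g hfg
  by_contra hg
  obtain ⟨b, a, ha, hab⟩ := hI.exists_inv hg
  obtain ⟨x, hx⟩ := exists_eq_zero_of_mem hI.ne_top
    (I.add_mem (I.mul_mem_left f hf) (I.mul_mem_left a ha))
  have hx' : f x * f x + a x * a x = 0 := hx
  have h1 : f x = 0 := by nlinarith [mul_self_nonneg (f x), mul_self_nonneg (a x)]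
  have h2 : a x = 0 := by nlinarith [mul_self_nonneg (f x), mul_self_nonneg (a x)]
  have h3 : g x = 0 := hfg h1
  have h4 : b x * g x + a x = 1 := DFunLike.congr_fun hab x
  simp [h2, h3] at h4

/-- The prime ideal of functions lying in eventually every prime along an ultrafilter. -/
def ultrafilterLimit (φ : Y → PrimeSpectrum (ContinuousMap T ℝ)) (F : Ultrafilter Y) :
    PrimeSpectrum (ContinuousMap T ℝ) where
  asIdeal :=
    { carrier := {f | ∀ᶠ x in F, f ∈ (φ x).asIdeal}
      add_mem' := fun hf hg => by
        filter_upwards [hf, hg] with x hx hy using add_mem hx hy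
      zero_mem' := .of_forall fun x => zero_mem _
      smul_mem' := fun c f hf => by
        filter_upwards [hf] with x hx using Ideal.mul_mem_left _ c hx }
  isPrime := by
    refine ⟨fun h => ?_, fun {f g} hfg => ?_⟩
    · have h1 : ∀ᶠ x in F, (1 : ContinuousMap T ℝ) ∈ (φ x).asIdeal :=
        (Ideal.eq_top_iff_one _).1 h
      obtain ⟨x, hx⟩ := h1.exists
      exact (φ x).isPrime.ne_top ((Ideal.eq_top_iff_one _).2 hx)
    · have h1 : ∀ᶠ x in F, f * g ∈ (φ x).asIdeal := hfg
      exact Ultrafilter.eventually_or.1 (h1.mono fun x hx => (φ x).isPrime.mem_or_mem hx)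

theorem isSpectralModel_specTop :
    IsSpectralModel (specTop T) (id : PrimeSpectrum (ContinuousMap T ℝ) → _) where
  injective := Function.injective_id
  isTopologicalBasis := PrimeSpectrum.isTopologicalBasis_basic_opens
  exists_limit F := ⟨ultrafilterLimit id F, fun _ => Iff.rfl⟩
  exists_eq_of_isMaximal I hI := ⟨⟨I, hI.isPrime⟩, rfl⟩

theorem isSpectralModel_zTop :
    IsSpectralModel (zTop T) (Subtype.val : zSpec T → _) where
  injective := Subtype.val_injective
  isTopologicalBasis := by
    have h := (PrimeSpectrum.isTopologicalBasis_basic_opens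
      (R := ContinuousMap T ℝ)).induced (Subtype.val : zSpec T → _)
    rwa [← range_comp] at h
  exists_limit F := by
    refine ⟨⟨ultrafilterLimit Subtype.val F, fun f hf g hfg => ?_⟩, fun _ => Iff.rfl⟩
    have h1 : ∀ᶠ x : zSpec T in (F : Filter (zSpec T)), f ∈ x.1.asIdeal := hf
    exact h1.mono fun x hx => x.2 f hx g hfg
  exists_eq_of_isMaximal I hI := ⟨⟨⟨I, hI.isPrime⟩, isZIdeal_of_isMaximal hI⟩, rfl⟩

namespace IsSpectralModel

variable {t : TopologicalSpace Y} {φ : Y → PrimeSpectrum (ContinuousMap T ℝ)}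

theorem isOpen_nonvanishing (H : IsSpectralModel t φ) (f : ContinuousMap T ℝ) :
    IsOpen[t] (nonvanishing φ f) :=
  H.isTopologicalBasis.isOpen (mem_range_self f)

theorem exists_mem_nonvanishing_subset (H : IsSpectralModel t φ) {U : Set Y}
    (hU : IsOpen[t] U) {y : Y} (hy : y ∈ U) :
    ∃ f, y ∈ nonvanishing φ f ∧ nonvanishing φ f ⊆ U := by
  obtain ⟨_, ⟨f, rfl⟩, h1, h2⟩ := H.isTopologicalBasis.exists_subset_of_mem_open hy hU
  exact ⟨f, h1, h2⟩

theorem le_nhds (H : IsSpectralModel t φ) {F : Ultrafilter Y} {y : Y}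
    (hy : ∀ f, f ∈ (φ y).asIdeal ↔ ∀ᶠ x in F, f ∈ (φ x).asIdeal) :
    (F : Filter Y) ≤ @nhds Y t y := by
  rw [H.isTopologicalBasis.nhds_hasBasis.ge_iff]
  rintro _ ⟨⟨f, rfl⟩, hf⟩
  exact Ultrafilter.eventually_not.2 ((hy f).not.1 hf)

theorem isCompact_nonvanishing (H : IsSpectralModel t φ) (f : ContinuousMap T ℝ) :
    @IsCompact Y t (nonvanishing φ f) := by
  rw [@isCompact_iff_ultrafilter_le_nhds Y t]
  intro F hF
  obtain ⟨y, hy⟩ := H.exists_limit F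
  refine ⟨y, fun hfy => ?_, H.le_nhds hy⟩
  obtain ⟨x, hx, hx'⟩ := (((hy f).1 hfy).and (Filter.le_principal_iff.1 hF)).exists
  exact hx' hx

theorem nonvanishing_mem_qcop (H : IsSpectralModel t φ) (f : ContinuousMap T ℝ) :
    nonvanishing φ f ∈ qcop t :=
  ⟨H.isOpen_nonvanishing f, H.isCompact_nonvanishing f⟩

theorem univ_mem_qcop (H : IsSpectralModel t φ) : (univ : Set Y) ∈ qcop t := by
  convert H.nonvanishing_mem_qcop 1
  exact (eq_univ_of_forall fun y hy =>
    (φ y).isPrime.ne_top ((Ideal.eq_top_iff_one _).2 hy)).symm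

theorem compl_nonvanishing_mem_qccl (H : IsSpectralModel t φ) (f : ContinuousMap T ℝ) :
    (nonvanishing φ f)ᶜ ∈ qccl t :=
  ⟨_, H.nonvanishing_mem_qcop f, rfl⟩

theorem patchTop_le (H : IsSpectralModel t φ) : patchTop t ≤ t := by
  rw [H.isTopologicalBasis.eq_generateFrom]
  refine le_generateFrom ?_
  rintro _ ⟨f, rfl⟩
  exact .basic _ (.inl (H.isTopologicalBasis.eq_generateFrom ▸ H.nonvanishing_mem_qcop f))

theorem patchTop_le_invTop (t : TopologicalSpace Y) : patchTop t ≤ invTop t :=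
  TopologicalSpace.generateFrom_anti subset_union_right

theorem compactSpace_patchTop (H : IsSpectralModel t φ) :
    @CompactSpace Y (patchTop t) := by
  refine @CompactSpace.mk _ (_) ?_
  rw [@isCompact_iff_ultrafilter_le_nhds Y (patchTop t)]
  intro F _
  obtain ⟨y, hy⟩ := H.exists_limit F
  refine ⟨y, mem_univ _, ?_⟩
  rw [patchTop, TopologicalSpace.nhds_generateFrom]
  simp only [le_iInf_iff, Filter.le_principal_iff]
  rintro s ⟨hys, hs | ⟨U, hU, rfl⟩⟩
  · exact H.le_nhds hy (hs.1.mem_nhds hys)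
  · rw [Ultrafilter.mem_coe, Ultrafilter.compl_mem_iff_notMem]
    intro hUF
    obtain ⟨x, hxU, hx⟩ := (@isCompact_iff_ultrafilter_le_nhds Y t U).1 hU.2 F
      (Filter.le_principal_iff.2 hUF)
    obtain ⟨f, hf, hfU⟩ := H.exists_mem_nonvanishing_subset hU.1 hxU
    refine hys (hfU fun hfy => ?_)
    obtain ⟨z, hz, hz'⟩ := (((hy f).1 hfy).and
      (hx ((H.isOpen_nonvanishing f).mem_nhds hf))).exists
    exact hz' hz

theorem isCompact_of_isClosed_patchTop (H : IsSpectralModel t φ) {S : Set Y}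
    (hS : IsClosed[patchTop t] S) {t' : TopologicalSpace Y} (h : patchTop t ≤ t') :
    @IsCompact Y t' S := by
  have := H.compactSpace_patchTop
  have h1 : @IsCompact Y (patchTop t) S := @IsClosed.isCompact Y (patchTop t) S this hS
  have := @IsCompact.image Y Y (patchTop t) t' S id h1 (continuous_id_iff_le.2 h)
  rwa [image_id] at this

theorem compl_nonvanishing_mem_qcop_invTop (H : IsSpectralModel t φ)
    (f : ContinuousMap T ℝ) : (nonvanishing φ f)ᶜ ∈ qcop (invTop t) := by
  refine ⟨.basic _ (H.compl_nonvanishing_mem_qccl f),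
    H.isCompact_of_isClosed_patchTop ?_ (patchTop_le_invTop t)⟩
  refine (@isClosed_compl_iff _ (patchTop t) _).2 (.basic _ (.inl (H.nonvanishing_mem_qcop f)))

theorem isClosed_of_mem_qcop_invTop {W : Set Y} (hW : W ∈ qcop (invTop t)) :
    IsClosed[t] W := by
  have hb := @TopologicalSpace.isTopologicalBasis_of_subbasis Y (invTop t) (qccl t) rfl
  have hbc : ∀ s ∈ (fun f : Set (Set Y) => ⋂₀ f) '' {f | f.Finite ∧ f ⊆ qccl t},
      IsClosed[t] s := by
    rintro _ ⟨f, ⟨-, hf⟩, rfl⟩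
    refine isClosed_sInter fun s hs => ?_
    obtain ⟨U, hU, rfl⟩ := hf hs
    exact (@isClosed_compl_iff _ t _).2 hU.1
  choose! B hB hyB hBW using fun y (hy : y ∈ W) =>
    @TopologicalSpace.IsTopologicalBasis.exists_subset_of_mem_open Y (invTop t) _ hb y W hy hW.1
  obtain ⟨s, hs⟩ := @IsCompact.elim_finite_subcover Y (invTop t) W _ hW.2 (fun y : W => B y)
    (fun y => @TopologicalSpace.IsTopologicalBasis.isOpen _ (invTop t) _ _ hb (hB y y.2))
    (fun y hy => mem_iUnion.2 ⟨⟨y, hy⟩, hyB y hy⟩)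
  rw [hs.antisymm (iUnion₂_subset fun y _ => hBW y y.2)]
  exact s.finite_toSet.isClosed_biUnion fun y _ => hbc _ (hB y y.2)

/-- The continuous map sending `x` to the maximal ideal of functions vanishing at `x`. -/
theorem exists_continuous_point (H : IsSpectralModel t φ) :
    ∃ e : T → Y, @Continuous T Y _ t e ∧ (∀ x, (φ (e x)).asIdeal.IsMaximal) ∧
      ∀ x f, f ∈ (φ (e x)).asIdeal ↔ f x = 0 := by
  have hmax (x : T) : (RingHom.ker (ContinuousMap.evalAlgHom ℝ ℝ x)).IsMaximal :=
    RingHom.ker_isMaximal_of_surjective _ fun r => ⟨ContinuousMap.const T r, rfl⟩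
  choose e he using fun x => H.exists_eq_of_isMaximal _ (hmax x)
  have hmem : ∀ x f, f ∈ (φ (e x)).asIdeal ↔ f x = 0 := by
    intro x f
    rw [he, RingHom.mem_ker]
    rfl
  refine ⟨e, ?_, fun x => he x ▸ hmax x, hmem⟩
  rw [H.isTopologicalBasis.continuous_iff]
  rintro _ ⟨f, rfl⟩
  have h : e ⁻¹' nonvanishing φ f = {x | f x ≠ 0} := by
    ext x
    exact (hmem x f).not
  rw [h]
  exact isOpen_ne_fun f.continuous continuous_const

theorem specLE_iff (H : IsSpectralModel t φ) (x y : Y) :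
    specLE t x y ↔ (φ x).asIdeal ≤ (φ y).asIdeal := by
  rw [specLE, H.isTopologicalBasis.mem_closure_iff]
  simp only [forall_mem_range, inter_singleton_nonempty]
  exact forall_congr' fun f => not_imp_not

theorem eq_of_isMaximal (H : IsSpectralModel t φ) {x y : Y} (hx : (φ x).asIdeal.IsMaximal)
    (h : (φ x).asIdeal ≤ (φ y).asIdeal) : y = x :=
  H.injective (PrimeSpectrum.ext (hx.eq_of_le (φ y).isPrime.ne_top h).symm)

theorem mem_maxPts_iff (H : IsSpectralModel t φ) (y : Y) :
    y ∈ maxPts t ↔ (φ y).asIdeal.IsMaximal := by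
  constructor
  · intro hy
    obtain ⟨I, hI, hle⟩ := Ideal.exists_le_maximal _ (φ y).isPrime.ne_top
    obtain ⟨z, rfl⟩ := H.exists_eq_of_isMaximal I hI
    rwa [← hy z ((H.specLE_iff y z).2 hle)]
  · exact fun hy z hz => H.eq_of_isMaximal hy ((H.specLE_iff y z).1 hz)

/-- If the lattice `L` is pseudocomplemented then cozero sets of `T` are closed. -/
theorem isClosed_of_pseudocomplemented (H : IsSpectralModel t φ) {L : Set (Set Y)}
    (hL : ∀ f, (nonvanishing φ f)ᶜ ∈ L) (hLc : ∀ W ∈ L, IsClosed[t] W)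
    (hpc : Pseudocomplemented L) (f : ContinuousMap T ℝ) : IsClosed {x | f x ≠ 0} := by
  obtain ⟨e, hec, -, hmem⟩ := H.exists_continuous_point
  obtain ⟨W, hW, hdisj, hlarge⟩ := hpc _ (hL f)
  convert @IsClosed.preimage _ _ _ t e hec W (hLc W hW) using 1
  ext x
  refine ⟨fun hx => ?_, fun hx hfx => ?_⟩
  · refine hlarge _ (hL (f - ContinuousMap.const T (f x))) ?_ ?_
    · refine eq_empty_of_forall_notMem fun y hy => ?_
      have hfy : f ∈ (φ y).asIdeal := not_not.1 hy.1
      have hgy : f - ContinuousMap.const T (f x) ∈ (φ y).asIdeal := not_not.1 hy.2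
      have hc : ContinuousMap.const T (f x) ∈ (φ y).asIdeal := by
        simpa using sub_mem hfy hgy
      obtain ⟨z, hz⟩ := exists_eq_zero_of_mem (φ y).isPrime.ne_top hc
      exact hx hz
    · simp [nonvanishing, hmem]
  · refine (eq_empty_iff_forall_notMem.1 hdisj) (e x) ⟨?_, hx⟩
    simpa [nonvanishing, hmem] using hfx

/-- If the lower set generated by each basic closed set is open then cozero sets of `T`
are closed. -/
theorem isClosed_of_isOpen_downset (H : IsSpectralModel t φ)
    (h : ∀ C ∈ qccl t, IsOpen[t] (downset t C)) (f : ContinuousMap T ℝ) :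
    IsClosed {x | f x ≠ 0} := by
  obtain ⟨e, hec, hmax, hmem⟩ := H.exists_continuous_point
  rw [← isOpen_compl_iff]
  convert @IsOpen.preimage _ _ _ t e hec _ (h _ (H.compl_nonvanishing_mem_qccl f)) using 1
  ext x
  simp only [mem_compl_iff, mem_ofPred_eq, not_not, mem_preimage]
  constructor
  · exact fun hx => ⟨e x, by simpa [nonvanishing, hmem] using hx,
      (H.specLE_iff _ _).2 le_rfl⟩
  · rintro ⟨y, hy, hxy⟩
    rw [H.eq_of_isMaximal (hmax x) ((H.specLE_iff _ _).1 hxy)] at hy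
    simpa [nonvanishing, hmem] using hy

theorem isClopen_patchTop_of_constructible_invTop (H : IsSpectralModel t φ) {S : Set Y}
    (hS : S ∈ Constructible (invTop t)) : @IsClopen Y (patchTop t) S := by
  refine hS {S | @IsClopen Y (patchTop t) S} ⟨fun W hW => ⟨?_, ?_⟩, fun s hs => ?_,
    fun s hs u hu => ?_, ?_⟩
  · exact (isClosed_of_mem_qcop_invTop hW).mono H.patchTop_le
  · exact patchTop_le_invTop t _ hW.1
  · exact @IsClopen.compl _ (patchTop t) _ hs
  · exact @IsClopen.union _ (patchTop t) _ _ hs hu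
  · exact @isClopen_empty _ (patchTop t)

theorem isClosed_of_isEsakia_invTop (H : IsSpectralModel t φ) (hE : IsEsakia (invTop t))
    (f : ContinuousMap T ℝ) : IsClosed {x | f x ≠ 0} := by
  refine H.isClosed_of_pseudocomplemented H.compl_nonvanishing_mem_qcop_invTop
    (fun _ => isClosed_of_mem_qcop_invTop) (fun U hU => ?_) f
  have hcl := hE U (mem_sInter.2 fun B hB => hB.1 hU)
  refine ⟨(@closure Y (invTop t) U)ᶜ, ⟨?_, ?_⟩, ?_, ?_⟩
  · exact @IsClosed.isOpen_compl _ (invTop t) _ (@isClosed_closure _ (invTop t) _)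
  · refine H.isCompact_of_isClosed_patchTop ?_ (patchTop_le_invTop t)
    exact (@IsClopen.compl _ (patchTop t) _
      (H.isClopen_patchTop_of_constructible_invTop hcl)).1
  · exact disjoint_compl_right.mono_left (@subset_closure _ (invTop t) _) |>.inter_eq
  · intro W hW hUW
    refine subset_compl_comm.1 (@closure_minimal _ (invTop t) _ _ ?_ ?_)
    · exact (disjoint_iff_inter_eq_empty.2 hUW).subset_compl_right
    · exact (@isClosed_compl_iff _ (invTop t) _).2 hW.1

/-- If the maximal points off each basic closed set form a compact set then cozero sets of
`T` are closed. -/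
theorem isClosed_of_isCompact_maxPts (H : IsSpectralModel t φ)
    (h : ∀ f, @IsCompact Y t (maxPts t ∩ nonvanishing φ f)) (f : ContinuousMap T ℝ) :
    IsClosed {x | f x ≠ 0} := by
  obtain ⟨e, -, hmax, hmem⟩ := H.exists_continuous_point
  let a (g : ContinuousMap T ℝ) : ContinuousMap T ℝ := g * f - 1
  let b (g : ContinuousMap T ℝ) : ContinuousMap T ℝ := (f * f - a g * a g) ⊔ 0
  have hcover : maxPts t ∩ nonvanishing φ f ⊆ ⋃ g, nonvanishing φ (b g) := by
    rintro y ⟨hy, hfy⟩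
    rw [H.mem_maxPts_iff] at hy
    obtain ⟨g, i, hi, hgi⟩ := hy.exists_inv hfy
    refine mem_iUnion.2 ⟨g, fun hb => ?_⟩
    have ha : a g ∈ (φ y).asIdeal := by
      have : a g = -i := by simp only [a, ← hgi]; ring
      exact this ▸ neg_mem hi
    obtain ⟨x, hx⟩ := exists_eq_zero_of_mem hy.ne_top
      (add_mem (Ideal.mul_mem_left _ (a g) ha) (Ideal.mul_mem_left _ (b g) hb))
    have hx' : a g x * a g x + b g x * b g x = 0 := hx
    have h1 : a g x = 0 := by nlinarith [mul_self_nonneg (a g x), mul_self_nonneg (b g x)]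
    have h2 : b g x = 0 := by nlinarith [mul_self_nonneg (a g x), mul_self_nonneg (b g x)]
    have h3 : g x * f x - 1 = 0 := h1
    have h4 : max (f x * f x - a g x * a g x) 0 = 0 := h2
    have h5 : f x = 0 := by
      have := max_eq_right_iff.1 h4
      rw [h1] at this
      nlinarith [mul_self_nonneg (f x)]
    simp [h5] at h3
  obtain ⟨s, hs⟩ := @IsCompact.elim_finite_subcover Y t _ _ (h f) _
    (fun g => H.isOpen_nonvanishing (b g)) hcover
  have hopen : IsOpen {x | ∀ g ∈ s, f x * f x < a g x * a g x} := by
    simp only [ofPred_forall]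
    exact isOpen_biInter_finset fun g _ => isOpen_lt (by fun_prop) (by fun_prop)
  rw [← isOpen_compl_iff]
  convert hopen using 1
  ext x
  simp only [mem_compl_iff, mem_ofPred_eq, not_not]
  constructor
  · intro hx g _
    simp [a, hx]
  · intro hx
    by_contra hfx
    have hex : e x ∈ maxPts t ∩ nonvanishing φ f :=
      ⟨(H.mem_maxPts_iff _).2 (hmax x), fun hc => hfx ((hmem x f).1 hc)⟩
    obtain ⟨g, hg, hbg⟩ := mem_iUnion₂.1 (hs hex)
    refine hbg ((hmem x _).2 ?_)
    exact max_eq_right (sub_nonpos.2 (hx g hg).le)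

theorem isCompact_maxPts_inter (H : IsSpectralModel t φ)
    (h : IsClosed[patchTop t] (maxPts t)) (f : ContinuousMap T ℝ) :
    @IsCompact Y t (maxPts t ∩ nonvanishing φ f) := by
  refine H.isCompact_of_isClosed_patchTop ?_ H.patchTop_le
  refine @IsClosed.inter _ _ _ (patchTop t) h ?_
  rw [← @isOpen_compl_iff _ _ (patchTop t)]
  exact .basic _ (.inr (H.compl_nonvanishing_mem_qccl f))

theorem isBooleanSpace (H : IsSpectralModel t φ)
    (hP : ∀ f : ContinuousMap T ℝ, IsClosed {x | f x ≠ 0}) : IsBooleanSpace t := by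
  have hclopen (f : ContinuousMap T ℝ) : @IsClopen Y t (nonvanishing φ f) := by
    refine ⟨?_, H.isOpen_nonvanishing f⟩
    have hc : Continuous fun x => (f x)⁻¹ := by
      refine continuous_iff_continuousAt.2 fun x => ?_
      by_cases hx : f x = 0
      · have h0 : ∀ᶠ z in 𝓝 x, f z = 0 := by
          filter_upwards [(hP f).isOpen_compl.mem_nhds (not_not.2 hx)] with z hz
          exact not_not.1 hz
        exact continuousAt_const.congr (h0.mono fun z hz => show (0 : ℝ) = _ by simp [hz])
      · exact f.continuous.continuousAt.inv₀ hx
    let u : ContinuousMap T ℝ := ⟨fun x => (f x)⁻¹, hc⟩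
    have hu : f * (1 - f * u) = 0 := by
      ext x
      by_cases hx : f x = 0 <;> simp [u, hx]
    rw [← @isOpen_compl_iff _ _ t]
    convert H.isOpen_nonvanishing (1 - f * u) using 1
    ext y
    simp only [nonvanishing, mem_compl_iff, mem_ofPred_eq, not_not]
    constructor
    · intro hf h1
      refine (φ y).isPrime.ne_top ((Ideal.eq_top_iff_one _).2 ?_)
      simpa using add_mem h1 (Ideal.mul_mem_right u _ hf)
    · intro h1
      exact ((φ y).isPrime.mem_or_mem (hu ▸ zero_mem _ : f * (1 - f * u) ∈ _)).resolve_right h1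
  refine ⟨@CompactSpace.mk _ t H.univ_mem_qcop.2, @T2Space.mk _ t fun x y hxy => ?_, ?_⟩
  · have hne : ∃ f, ¬(f ∈ (φ x).asIdeal ↔ f ∈ (φ y).asIdeal) := by
      by_contra! h
      exact hxy (H.injective (PrimeSpectrum.ext (Ideal.ext h)))
    obtain ⟨f, hf⟩ := hne
    have hd := disjoint_compl_right (a := nonvanishing φ f)
    by_cases hx : f ∈ (φ x).asIdeal
    · have hy : f ∉ (φ y).asIdeal := fun hy => hf (iff_of_true hx hy)
      exact ⟨_, _, (hclopen f).compl.2, (hclopen f).2, not_not.2 hx, hy, hd.symm⟩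
    · have hy : f ∈ (φ y).asIdeal := by_contra fun hy => hf (iff_of_false hx hy)
      exact ⟨_, _, (hclopen f).2, (hclopen f).compl.2, hx, not_not.2 hy, hd⟩
  · refine @TopologicalSpace.isTopologicalBasis_of_isOpen_of_nhds Y t _ (fun U hU => hU.2)
      fun y U hy hU => ?_
    obtain ⟨f, h1, h2⟩ := H.exists_mem_nonvanishing_subset hU hy
    exact ⟨_, hclopen f, h1, h2⟩

end IsSpectralModel

end SpectralModels

namespace PCF.IsBooleanSpace

variable {Y : Type*} {t : TopologicalSpace Y}

theorem mem_qcop_iff (hB : IsBooleanSpace t) {U : Set Y} :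
    U ∈ qcop t ↔ @IsClopen Y t U := by
  obtain ⟨_, _, _⟩ := hB
  exact ⟨fun h => ⟨h.2.isClosed, h.1⟩, fun h => ⟨h.2, h.1.isCompact⟩⟩

theorem mem_qccl_iff (hB : IsBooleanSpace t) {U : Set Y} :
    U ∈ qccl t ↔ @IsClopen Y t U := by
  constructor
  · rintro ⟨V, hV, rfl⟩
    exact (hB.mem_qcop_iff.1 hV).compl
  · exact fun h => ⟨Uᶜ, hB.mem_qcop_iff.2 h.compl, (compl_compl U).symm⟩

theorem qcop_eq (hB : IsBooleanSpace t) : qcop t = {U | @IsClopen Y t U} :=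
  ext fun _ => hB.mem_qcop_iff

theorem qccl_eq (hB : IsBooleanSpace t) : qccl t = {U | @IsClopen Y t U} :=
  ext fun _ => hB.mem_qccl_iff

theorem invTop_eq (hB : IsBooleanSpace t) : invTop t = t := by
  rw [invTop, hB.qccl_eq, ← hB.2.2.eq_generateFrom]

theorem patchTop_eq (hB : IsBooleanSpace t) : patchTop t = t := by
  rw [patchTop, hB.qccl_eq, hB.qcop_eq, union_self, ← hB.2.2.eq_generateFrom]

theorem specLE_iff (hB : IsBooleanSpace t) {x y : Y} : specLE t x y ↔ y = x := by
  obtain ⟨_, _, _⟩ := hB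
  rw [specLE, closure_singleton, mem_singleton_iff]

theorem isPseudoCompl_isClopen_iff {U V : Set Y} (hU : @IsClopen Y t U) :
    IsPseudoCompl {W | @IsClopen Y t W} U V ↔ V = Uᶜ := by
  constructor
  · rintro ⟨-, h1, h2⟩
    exact ((disjoint_iff_inter_eq_empty.2 h1).subset_compl_left).antisymm
      (h2 _ hU.compl (inter_compl_self U))
  · rintro rfl
    exact ⟨hU.compl, inter_compl_self U, fun W _ hW =>
      (disjoint_iff_inter_eq_empty.2 hW).subset_compl_left⟩

theorem stoneAlgebra_qccl (hB : IsBooleanSpace t) : StoneAlgebra (qccl t) := by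
  rw [hB.qccl_eq]
  refine ⟨fun U hU => ⟨Uᶜ, (isPseudoCompl_isClopen_iff hU).2 rfl⟩, ?_⟩
  intro U hU V W hV hW
  rw [(isPseudoCompl_isClopen_iff hV.1).1 hW, union_compl_self]

theorem isPCSpace_invTop (hB : IsBooleanSpace t) : IsPCSpace (invTop t) := by
  rw [hB.invTop_eq, IsPCSpace, hB.qcop_eq, ← hB.qccl_eq]
  exact hB.stoneAlgebra_qccl.1

theorem isEsakia_invTop (hB : IsBooleanSpace t) : IsEsakia (invTop t) := by
  rw [hB.invTop_eq]
  intro S hS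
  have hcl : @IsClopen Y t S := hS {S | @IsClopen Y t S}
    ⟨hB.qcop_eq.subset, fun _ => IsClopen.compl, fun _ hs _ hu => hs.union hu, isClopen_empty⟩
  rwa [hcl.1.closure_eq]

theorem maxPtsIn_eq (hB : IsBooleanSpace t) (U : Set Y) : maxPtsIn t U = U :=
  ext fun _ => ⟨fun h => h.1, fun h => ⟨h, fun _ _ => hB.specLE_iff.1⟩⟩

theorem maxPts_eq (hB : IsBooleanSpace t) : maxPts t = univ :=
  eq_univ_of_forall fun _ _ => hB.specLE_iff.1

theorem downset_eq (hB : IsBooleanSpace t) (U : Set Y) : downset t U = U := by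
  ext x
  simp [downset, hB.specLE_iff]

end PCF.IsBooleanSpace

theorem PCF.maxPtsIn_univ {Y : Type*} (t : TopologicalSpace Y) : maxPtsIn t univ = maxPts t := by
  simp [maxPtsIn, maxPts]

namespace IsSpectralModel

variable {T Y : Type*} [TopologicalSpace T] {t : TopologicalSpace Y}
  {φ : Y → PrimeSpectrum (ContinuousMap T ℝ)}

theorem tfae (H : IsSpectralModel t φ) :
    List.TFAE
      [ ∀ f : ContinuousMap T ℝ, IsClosed {x | f x ≠ 0},
        IsBooleanSpace t,
        StoneAlgebra (qccl t),
        IsEsakia (invTop t),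
        IsPCSpace (invTop t),
        IsClosed[patchTop t] (maxPts t),
        ∀ U ∈ qcop t, IsClosed[patchTop t] (maxPtsIn t U),
        ∀ U ∈ qcop t, ∀ V ∈ qcop t, @IsCompact _ t (maxPtsIn t U ∩ V),
        ∀ C ∈ qccl t, IsOpen[t] (downset t C),
        ∀ C ∈ qccl t, @IsClopen _ t (downset t C) ] := by
  tfae_have 1 → 2 := H.isBooleanSpace
  tfae_have 2 → 3 := fun hB => hB.stoneAlgebra_qccl
  tfae_have 2 → 4 := fun hB => hB.isEsakia_invTop
  tfae_have 2 → 5 := fun hB => hB.isPCSpace_invTop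
  tfae_have 2 → 7 := fun hB U hU => by
    rw [hB.maxPtsIn_eq, hB.patchTop_eq]
    exact (hB.mem_qcop_iff.1 hU).1
  tfae_have 2 → 8 := fun hB U hU V hV => by
    rw [hB.maxPtsIn_eq]
    exact (hB.mem_qcop_iff.2 ((hB.mem_qcop_iff.1 hU).inter (hB.mem_qcop_iff.1 hV))).2
  tfae_have 2 → 10 := fun hB C hC => by
    rw [hB.downset_eq]
    exact hB.mem_qccl_iff.1 hC
  tfae_have 10 → 9 := fun h C hC => (h C hC).2
  tfae_have 9 → 1 := H.isClosed_of_isOpen_downset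
  tfae_have 3 → 1 := fun h => by
    refine H.isClosed_of_pseudocomplemented H.compl_nonvanishing_mem_qccl ?_ h.1
    rintro _ ⟨U, hU, rfl⟩
    exact hU.1.isClosed_compl
  tfae_have 4 → 1 := H.isClosed_of_isEsakia_invTop
  tfae_have 5 → 1 := H.isClosed_of_pseudocomplemented H.compl_nonvanishing_mem_qcop_invTop
    fun _ => isClosed_of_mem_qcop_invTop
  tfae_have 7 → 6 := fun h => maxPtsIn_univ t ▸ h univ H.univ_mem_qcop
  tfae_have 6 → 1 := fun h => H.isClosed_of_isCompact_maxPts (H.isCompact_maxPts_inter h)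
  tfae_have 8 → 1 := fun h => H.isClosed_of_isCompact_maxPts fun f =>
    maxPtsIn_univ t ▸ h univ H.univ_mem_qcop _ (H.nonvanishing_mem_qcop f)
  tfae_finish

end IsSpectralModel

/-- For a completely regular Hausdorff space `T`, with `X = Spec C(T)` and
`Z = zSpec C(T)`, TFAE: (i) `T` is a P-space, i.e. `X` is Boolean; (ii) `Z` is Boolean;
(iii) `qccl Z` is a Stone algebra; (iv) the inverse space of `Z` is Esakia; (v) the
inverse space of `Z` is a PC-space; (vi) `Z^max` is patch closed; (vii) `U^max` is patch
closed for all `U ∈ qcop Z`; (viii) `U^max ∩ V` is compact for all `U, V ∈ qcop Z`;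
(ix) `↓C` is open in `Z` for every `C ∈ qccl Z`; (x) `↓C` is clopen in `Z` for every
`C ∈ qccl Z`; together with conditions (iii)-(x) formulated for `X` instead of `Z`. -/
theorem statement_10 {T : Type*} [TopologicalSpace T] [CompletelyRegularSpace T]
    [T2Space T] :
    List.TFAE
      [ IsBooleanSpace (specTop T),
        IsBooleanSpace (zTop T),
        StoneAlgebra (qccl (zTop T)),
        IsEsakia (invTop (zTop T)),
        IsPCSpace (invTop (zTop T)),
        IsClosed[patchTop (zTop T)] (maxPts (zTop T)),
        ∀ U ∈ qcop (zTop T), IsClosed[patchTop (zTop T)] (maxPtsIn (zTop T) U),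
        ∀ U ∈ qcop (zTop T), ∀ V ∈ qcop (zTop T),
          @IsCompact _ (zTop T) (maxPtsIn (zTop T) U ∩ V),
        ∀ C ∈ qccl (zTop T), IsOpen[zTop T] (downset (zTop T) C),
        ∀ C ∈ qccl (zTop T), @IsClopen _ (zTop T) (downset (zTop T) C),
        StoneAlgebra (qccl (specTop T)),
        IsEsakia (invTop (specTop T)),
        IsPCSpace (invTop (specTop T)),
        IsClosed[patchTop (specTop T)] (maxPts (specTop T)),
        ∀ U ∈ qcop (specTop T), IsClosed[patchTop (specTop T)] (maxPtsIn (specTop T) U),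
        ∀ U ∈ qcop (specTop T), ∀ V ∈ qcop (specTop T),
          @IsCompact _ (specTop T) (maxPtsIn (specTop T) U ∩ V),
        ∀ C ∈ qccl (specTop T), IsOpen[specTop T] (downset (specTop T) C),
        ∀ C ∈ qccl (specTop T), @IsClopen _ (specTop T) (downset (specTop T) C) ] := by
  have hX := (isSpectralModel_specTop (T := T)).tfae
  have hZ := (isSpectralModel_zTop (T := T)).tfae
  have hX' := fun a ha => hX a ha (∀ f : ContinuousMap T ℝ, IsClosed {x | f x ≠ 0}) (by simp)
  have hZ' := fun a ha => hZ a ha (∀ f : ContinuousMap T ℝ, IsClosed {x | f x ≠ 0}) (by simp)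
  refine List.tfae_of_forall (∀ f : ContinuousMap T ℝ, IsClosed {x | f x ≠ 0}) _ ?_
  simp only [List.forall_mem_cons] at hX' hZ' ⊢
  obtain ⟨-, x1, hX'⟩ := hX'
  obtain ⟨-, z1, z2, z3, z4, z5, z6, z7, z8, z9, -⟩ := hZ'
  exact ⟨x1, z1, z2, z3, z4, z5, z6, z7, z8, z9, hX'⟩
end

section
/- Let T be a completely regular Hausdorff space. Then T is cozero complemented if and only if the set of minimal prime ideals of C(T), viewed as a subspace of Spec C(T), is compact. -/
open Set Topology

open PCF

section MinimalPrimes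

variable {R : Type*} [CommRing R]

/-- A prime is minimal in the prime spectrum iff its ideal is a minimal prime ideal. -/
theorem forall_le_imp_eq_iff_mem_minimalPrimes (p : PrimeSpectrum R) :
    (∀ q : PrimeSpectrum R, q.asIdeal ≤ p.asIdeal → q = p) ↔
      p.asIdeal ∈ minimalPrimes R := by
  rw [minimalPrimes_eq_minimals]
  refine ⟨fun h => ⟨p.isPrime, fun q hq hle => ?_⟩, fun h q hle => ?_⟩
  · exact (congrArg PrimeSpectrum.asIdeal (h ⟨q, hq⟩ hle)).ge
  · exact PrimeSpectrum.ext (le_antisymm hle (h.2 q.isPrime hle))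

/-- In a reduced ring, every element of a minimal prime is annihilated by an element
outside of it. -/
theorem exists_notMem_mul_eq_zero [IsReduced R] {p : Ideal R} (hp : p ∈ minimalPrimes R)
    {f : R} (hf : f ∈ p) : ∃ g ∉ p, f * g = 0 := by
  have := Ideal.IsMinimalPrime.isPrime hp
  have hzero : (0 : R) ∈ Submonoid.powers f ⊔ p.primeCompl := by
    by_contra h0
    obtain ⟨q, hq, -, hdisj⟩ := Ideal.exists_le_prime_disjoint ⊥
      (Submonoid.powers f ⊔ p.primeCompl) (disjoint_left.2 fun x hx hxS => h0 (by
        rwa [(Ideal.mem_bot.1 hx : x = 0)] at hxS))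
    have hqp : q ≤ p := fun x hx => by
      by_contra hxp
      exact disjoint_left.1 hdisj hx (Submonoid.mem_sup_right hxp)
    exact disjoint_left.1 hdisj (hp.2 ⟨hq, bot_le⟩ hqp hf)
      (Submonoid.mem_sup_left (Submonoid.mem_powers f))
  obtain ⟨_, ⟨n, rfl⟩, g, hg, hfg⟩ := Submonoid.mem_sup.1 hzero
  refine ⟨g, hg, IsReduced.eq_zero _ ⟨n + 1, ?_⟩⟩
  have hfg' : f ^ n * g = 0 := hfg
  linear_combination f * g ^ n * hfg'

/-- In a reduced ring, every nonzero element is avoided by some minimal prime. -/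
theorem exists_minimalPrimes_notMem [IsReduced R] {h : R} (hh : h ≠ 0) :
    ∃ p : PrimeSpectrum R, p.asIdeal ∈ minimalPrimes R ∧ h ∉ p.asIdeal := by
  by_contra! hcon
  apply hh
  have hmem : h ∈ sInf (minimalPrimes R) :=
    Ideal.mem_sInf.2 fun {p} hp => hcon ⟨p, Ideal.IsMinimalPrime.isPrime hp⟩ hp
  have : sInf (minimalPrimes R) = (⊥ : Ideal R).radical := Ideal.sInf_minimalPrimes
  rw [this] at hmem
  obtain ⟨n, hn⟩ := hmem
  exact IsReduced.eq_zero h ⟨n, hn⟩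

/-- The ideal of elements lying in `U`-almost all primes, for an ultrafilter `U`. -/
def ultrafilterLimitIdeal (U : Ultrafilter (PrimeSpectrum R)) : Ideal R where
  carrier := {f | ∀ᶠ p in (U : Filter (PrimeSpectrum R)), f ∈ p.asIdeal}
  add_mem' ha hb := by
    filter_upwards [ha, hb] with p h1 h2 using p.asIdeal.add_mem h1 h2
  zero_mem' := Filter.Eventually.of_forall fun p => p.asIdeal.zero_mem
  smul_mem' c f hf := by
    filter_upwards [hf] with p h using p.asIdeal.mul_mem_left c h

theorem ultrafilterLimitIdeal_isPrime (U : Ultrafilter (PrimeSpectrum R)) :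
    (ultrafilterLimitIdeal U).IsPrime := by
  refine ⟨fun h => ?_, fun {a b} hab => ?_⟩
  · have h1 : ∀ᶠ p in (U : Filter (PrimeSpectrum R)), (1 : R) ∈ p.asIdeal :=
      (Ideal.eq_top_iff_one _).1 h
    obtain ⟨p, hp⟩ := h1.exists
    exact p.isPrime.ne_top ((Ideal.eq_top_iff_one _).2 hp)
  · have h1 : ∀ᶠ p in (U : Filter (PrimeSpectrum R)), a ∈ p.asIdeal ∨ b ∈ p.asIdeal :=
      Filter.Eventually.mono hab fun p hp => p.isPrime.mem_or_mem hp
    exact Ultrafilter.eventually_or.1 h1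

/-- If every element `f` has an annihilating `g` such that no minimal prime contains both,
then the space of minimal primes is compact. -/
theorem isCompact_minimalPrimes_of_exists_compl
    (H : ∀ f : R, ∃ g, f * g = 0 ∧ ∀ p ∈ minimalPrimes R, f ∈ p → g ∉ p) :
    IsCompact {p : PrimeSpectrum R | p.asIdeal ∈ minimalPrimes R} := by
  rw [isCompact_iff_ultrafilter_le_nhds]
  intro U hU
  have := ultrafilterLimitIdeal_isPrime U
  obtain ⟨q, hq, hle⟩ := Ideal.exists_minimalPrimes_le (bot_le : ⊥ ≤ ultrafilterLimitIdeal U)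
  have hqp : q.IsPrime := Ideal.IsMinimalPrime.isPrime hq
  refine ⟨⟨q, hqp⟩, hq, ?_⟩
  rw [PrimeSpectrum.isTopologicalBasis_basic_opens.nhds_hasBasis.ge_iff]
  rintro _ ⟨⟨f, rfl⟩, hf⟩
  obtain ⟨g, hfg, hg⟩ := H f
  have hgq : g ∈ q := (hqp.mem_or_mem (hfg ▸ q.zero_mem : f * g ∈ q)).resolve_left hf
  have hev : ∀ᶠ p in (U : Filter (PrimeSpectrum R)), g ∈ p.asIdeal := hle hgq
  filter_upwards [hev, Filter.le_principal_iff.1 hU] with p hp hpm hfp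
  exact hg _ hpm hfp hp

/-- If the space of minimal primes of a reduced ring is compact, then each element `f` has
finitely many annihilating elements such that only `0` annihilates all of them and `f`. -/
theorem exists_finset_compl_of_isCompact_minimalPrimes [IsReduced R]
    (H : IsCompact {p : PrimeSpectrum R | p.asIdeal ∈ minimalPrimes R}) (f : R) :
    ∃ s : Finset R, (∀ g ∈ s, f * g = 0) ∧
      ∀ h, h * f = 0 → (∀ g ∈ s, h * g = 0) → h = 0 := by
  have hK := H.inter_right (PrimeSpectrum.isClosed_zeroLocus {f})
  obtain ⟨t, hts, htf, hcov⟩ := hK.elim_finite_subcover_image (b := {g | f * g = 0})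
    (c := fun g => (PrimeSpectrum.basicOpen g : Set (PrimeSpectrum R)))
    (fun g _ => (PrimeSpectrum.basicOpen g).isOpen) (by
      rintro p ⟨hp, hpf⟩
      obtain ⟨g, hg, hfg⟩ := exists_notMem_mul_eq_zero hp (hpf rfl)
      exact mem_biUnion (show g ∈ {g | f * g = 0} from hfg) hg)
  refine ⟨htf.toFinset, fun g hg => hts (htf.mem_toFinset.1 hg), fun h hf hg => ?_⟩
  by_contra hh
  obtain ⟨p, hp, hhp⟩ := exists_minimalPrimes_notMem hh
  have key : ∀ k, h * k = 0 → k ∈ p.asIdeal := fun k hk =>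
    (p.isPrime.mem_or_mem (hk ▸ p.asIdeal.zero_mem : h * k ∈ p.asIdeal)).resolve_left hhp
  have hpf : p ∈ PrimeSpectrum.zeroLocus {f} := by
    simpa [PrimeSpectrum.mem_zeroLocus] using key f hf
  obtain ⟨g, hgt, hgp⟩ := mem_iUnion₂.1 (hcov ⟨hp, hpf⟩)
  exact hgp (key g (hg g (htf.mem_toFinset.2 hgt)))

end MinimalPrimes

/-- A set in a completely regular space is dense if only the zero function vanishes on it. -/
theorem dense_of_forall_eq_zero {T : Type*} [TopologicalSpace T] [CompletelyRegularSpace T]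
    {A : Set T} (H : ∀ h : ContinuousMap T ℝ, (∀ t ∈ A, h t = 0) → h = 0) : Dense A := by
  intro x
  by_contra hx
  obtain ⟨φ, hφ, hφx, hφA⟩ :=
    CompletelyRegularSpace.completely_regular x (closure A) isClosed_closure hx
  have := H ⟨fun t => 1 - (φ t : ℝ), by fun_prop⟩ fun t ht => by
    simp [hφA (subset_closure ht)]
  have hx0 := DFunLike.congr_fun this x
  simp [hφx] at hx0

instance isReduced_continuousMap_real {T : Type*} [TopologicalSpace T] :
    IsReduced (ContinuousMap T ℝ) where
  eq_zero f := by
    rintro ⟨n, hn⟩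
    ext t
    exact eq_zero_of_pow_eq_zero (n := n) (DFunLike.congr_fun hn t)

/-- A continuous real function with dense cozero set lies in no minimal prime ideal. -/
theorem notMem_minimalPrimes_of_dense {T : Type*} [TopologicalSpace T]
    {k : ContinuousMap T ℝ} (hk : Dense {t | k t ≠ 0})
    {p : Ideal (ContinuousMap T ℝ)} (hp : p ∈ minimalPrimes (ContinuousMap T ℝ)) :
    k ∉ p := by
  intro hkp
  obtain ⟨g, hg, hkg⟩ := exists_notMem_mul_eq_zero hp hkp
  refine hg ?_
  have : g = 0 := by
    refine DFunLike.coe_injective (g.continuous.ext_on hk continuous_const fun t ht => ?_)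
    exact (mul_eq_zero.1 (DFunLike.congr_fun hkg t)).resolve_left ht
  exact this ▸ p.zero_mem

/-- A completely regular Hausdorff space `T` is cozero complemented iff
the set of minimal prime ideals of `C(T)` is a compact subspace of `Spec C(T)`. -/
theorem statement_11 {T : Type*} [TopologicalSpace T] [CompletelyRegularSpace T]
    [T2Space T] :
    (∀ U ∈ Coz T, ∃ V ∈ Coz T, U ∩ V = ∅ ∧ Dense (U ∪ V)) ↔
      IsCompact {p : PrimeSpectrum (ContinuousMap T ℝ) |
        ∀ q : PrimeSpectrum (ContinuousMap T ℝ), q.asIdeal ≤ p.asIdeal → q = p} := by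
  simp_rw [forall_le_imp_eq_iff_mem_minimalPrimes]
  refine ⟨fun H => isCompact_minimalPrimes_of_exists_compl fun f => ?_, ?_⟩
  · obtain ⟨_, ⟨g, rfl⟩, hdisj, hdense⟩ := H _ ⟨f, rfl⟩
    refine ⟨g, ?_, fun p hp hfp hgp => ?_⟩
    · ext t
      by_contra ht
      have hne : f t * g t ≠ 0 := ht
      exact eq_empty_iff_forall_notMem.1 hdisj t (mul_ne_zero_iff.1 hne)
    · refine notMem_minimalPrimes_of_dense (k := f * f + g * g) (hdense.mono fun t ht => ?_) hp
        (p.add_mem (p.mul_mem_left f hfp) (p.mul_mem_left g hgp))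
      intro h0
      have := mul_self_add_mul_self_eq_zero.1 (show f t * f t + g t * g t = 0 from h0)
      exact ht.elim (fun h => h this.1) (fun h => h this.2)
  · rintro H _ ⟨f, rfl⟩
    obtain ⟨s, hs, hzero⟩ := exists_finset_compl_of_isCompact_minimalPrimes H f
    have hsum (t : T) : (∑ g ∈ s, g * g) t = ∑ g ∈ s, g t * g t := by
      simp [ContinuousMap.coe_sum]
    refine ⟨_, ⟨∑ g ∈ s, g * g, rfl⟩, ?_, dense_of_forall_eq_zero fun h hh => ?_⟩
    · refine eq_empty_of_forall_notMem fun t ht => ht.2 ?_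
      rw [hsum]
      refine Finset.sum_eq_zero fun g hg => ?_
      have : f t * g t = 0 := DFunLike.congr_fun (hs g hg) t
      simp [(mul_eq_zero.1 this).resolve_left ht.1]
    · refine hzero h ?_ fun g hg => ?_
      · ext t
        by_contra ht
        have hne : h t * f t ≠ 0 := ht
        exact (mul_ne_zero_iff.1 hne).1 (hh t (Or.inl (mul_ne_zero_iff.1 hne).2))
      · ext t
        by_contra ht
        have hne : h t * g t ≠ 0 := ht
        obtain ⟨h1, h2⟩ := mul_ne_zero_iff.1 hne
        refine h1 (hh t (Or.inr fun h0 => h2 ?_))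
        rw [hsum] at h0
        exact mul_self_eq_zero.1
          ((Finset.sum_eq_zero_iff_of_nonneg fun k _ => mul_self_nonneg (k t)).1 h0 g hg)
end

section
/- Let T be a completely regular Hausdorff space. The lattice Coz(T) of cozero sets of T is pseudocomplemented if and only if the closure of every cozero set of T is a zero set (equivalently, for every cozero set U of T, the complement T \ closure(U) is again a cozero set). -/
open Set Topology

open PCF

/-- Cozero sets are open. -/
theorem isOpen_of_mem_coz {T : Type*} [TopologicalSpace T] {U : Set T} (hU : U ∈ Coz T) :
    IsOpen U := by
  obtain ⟨f, rfl⟩ := hU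
  exact isOpen_ne_fun f.continuous continuous_const

/-- In a completely regular space the cozero sets form a basis of the topology. -/
theorem exists_mem_coz_subset {T : Type*} [TopologicalSpace T] [CompletelyRegularSpace T]
    {O : Set T} (hO : IsOpen O) {x : T} (hx : x ∈ O) : ∃ W ∈ Coz T, x ∈ W ∧ W ⊆ O := by
  obtain ⟨f, hf, hfx, hfO⟩ := CompletelyRegularSpace.completely_regular_isOpen x O hO hx
  refine ⟨_, ⟨⟨fun t => 1 - (f t : ℝ), by fun_prop⟩, rfl⟩, by simp [hfx], fun t ht => ?_⟩
  by_contra htO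
  exact ht (by simp [hfO htO])

/-- In the lattice of cozero sets of a completely regular space, the only possible
pseudocomplement of an element is the complement of its closure. -/
theorem isPseudoCompl_coz_iff {T : Type*} [TopologicalSpace T] [CompletelyRegularSpace T]
    {U V : Set T} : IsPseudoCompl (Coz T) U V ↔ V ∈ Coz T ∧ V = (closure U)ᶜ := by
  have disjoint_closure {W : Set T} (hW : W ∈ Coz T) (h : U ∩ W = ∅) : W ⊆ (closure U)ᶜ :=
    subset_compl_iff_disjoint_left.mpr
      ((disjoint_iff_inter_eq_empty.mpr h).closure_left (isOpen_of_mem_coz hW))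
  constructor
  · rintro ⟨hV, hUV, hmax⟩
    refine ⟨hV, (disjoint_closure hV hUV).antisymm fun x hx => ?_⟩
    obtain ⟨W, hW, hxW, hWU⟩ := exists_mem_coz_subset isClosed_closure.isOpen_compl hx
    refine hmax W hW (disjoint_iff_inter_eq_empty.mp ?_) hxW
    exact (subset_compl_iff_disjoint_left.mp hWU).mono_left subset_closure
  · rintro ⟨hV, rfl⟩
    refine ⟨hV, disjoint_iff_inter_eq_empty.mp ?_, fun W hW h => disjoint_closure hW h⟩
    exact disjoint_compl_right.mono_left subset_closure

/-- A set is a zero set iff its complement is a cozero set. -/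
theorem compl_mem_coz_iff {T : Type*} [TopologicalSpace T] {S : Set T} :
    Sᶜ ∈ Coz T ↔ ∃ f : ContinuousMap T ℝ, S = zeroSet T f :=
  exists_congr fun _ => compl_inj_iff

/-- For a completely regular Hausdorff space `T`, the lattice `Coz T` of
cozero sets is pseudocomplemented iff the closure of every cozero set is a zero set,
equivalently iff the complement of the closure of every cozero set is a cozero set. -/
theorem statement_12 {T : Type*} [TopologicalSpace T] [CompletelyRegularSpace T]
    [T2Space T] :
    List.TFAE
      [ Pseudocomplemented (Coz T),
        ∀ U ∈ Coz T, ∃ f : ContinuousMap T ℝ, closure U = zeroSet T f,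
        ∀ U ∈ Coz T, (closure U)ᶜ ∈ Coz T ] := by
  tfae_have 1 ↔ 3 := by
    simp only [Pseudocomplemented, isPseudoCompl_coz_iff, exists_eq_right]
  tfae_have 2 ↔ 3 := by
    simp only [compl_mem_coz_iff]
  tfae_finish
end

section
/- Let T be a completely regular Hausdorff space and let X ⊆ Spec C(T) be patch closed and convex for specialization (i.e. if p ⊆ q ⊆ r are prime ideals of C(T) with p, r ∈ X, then q ∈ X), regarded as a spectral space with the subspace topology. The following are equivalent: (i) X is a PC-space; (ii) qcop(X) is a Stone algebra; (iii) X^min is patch closed and X is stranded. -/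
open Set Topology

open PCF

section ContinuousFunctions

open Filter

variable {T : Type*} [TopologicalSpace T]

/-- Prime ideals of `C(T)` are absolutely convex. -/
theorem mem_of_abs_le {p : Ideal C(T, ℝ)} (hp : p.IsPrime) {a b : C(T, ℝ)} (hb : b ∈ p)
    (hab : ∀ t, |a t| ≤ |b t|) : a ∈ p := by
  have hbound : ∀ t, |a t ^ 2 / b t| ≤ |b t| := by
    intro t
    rw [abs_div, abs_pow]
    refine div_le_of_le_mul₀ (abs_nonneg _) (abs_nonneg _) ?_
    nlinarith [hab t, abs_nonneg (a t), abs_nonneg (b t)]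
  have hcont : Continuous fun t => a t ^ 2 / b t := by
    rw [continuous_iff_continuousAt]
    intro t
    by_cases hbt : b t = 0
    · have hlim : Tendsto (fun t => |b t|) (𝓝 t) (𝓝 0) := by
        have := (b.continuous.abs).tendsto t
        simpa [hbt] using this
      have := squeeze_zero_norm (f := fun t => a t ^ 2 / b t)
        (fun t => (Real.norm_eq_abs _).trans_le (hbound t)) hlim
      simpa [ContinuousAt, hbt] using this
    · exact (a.continuous.continuousAt.pow 2).div b.continuous.continuousAt hbt
  have hsq : a ^ 2 = b * ⟨_, hcont⟩ := by
    ext t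
    by_cases hbt : b t = 0
    · have : a t = 0 := by simpa [hbt] using hab t
      simp [hbt, this]
    · simp [mul_div_cancel₀ _ hbt]
  exact hp.mem_of_pow_mem 2 (hsq ▸ p.mul_mem_right _ hb)

theorem mem_of_abs_le_add {p : Ideal C(T, ℝ)} (hp : p.IsPrime) {a b c : C(T, ℝ)}
    (hb : b ∈ p) (hc : c ∈ p) (h : ∀ t, |a t| ≤ |b t| + |c t|) : a ∈ p := by
  have hb' : |b| ∈ p := mem_of_abs_le hp hb fun t => by simp
  have hc' : |c| ∈ p := mem_of_abs_le hp hc fun t => by simp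
  refine mem_of_abs_le hp (p.add_mem hb' hc') fun t => ?_
  have := h t
  simpa [abs_of_nonneg (add_nonneg (abs_nonneg (b t)) (abs_nonneg (c t)))] using this

/-- If two primes of `C(T)` are incomparable, they are separated by functions with product
zero. -/
theorem exists_mul_eq_zero_of_not_le {q₁ q₂ : Ideal C(T, ℝ)} (h₁ : q₁.IsPrime)
    (h₂ : q₂.IsPrime) (h₁₂ : ¬ q₁ ≤ q₂) (h₂₁ : ¬ q₂ ≤ q₁) :
    ∃ f g : C(T, ℝ), f * g = 0 ∧ f ∈ q₁ ∧ f ∉ q₂ ∧ g ∈ q₂ ∧ g ∉ q₁ := by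
  obtain ⟨f, hf₁, hf₂⟩ := SetLike.not_le_iff_exists.1 h₁₂
  obtain ⟨g, hg₂, hg₁⟩ := SetLike.not_le_iff_exists.1 h₂₁
  have key : ∀ (x y : ℝ), |max (|x| - |y|) 0| ≤ |x| ∧ |x| ≤ |max (|x| - |y|) 0| + |y| := by
    intro x y
    rw [abs_of_nonneg (le_max_right _ _)]
    exact ⟨max_le (by linarith [abs_nonneg y]) (abs_nonneg x),
      by linarith [le_max_left (|x| - |y|) 0]⟩
  refine ⟨(|f| - |g|) ⊔ 0, (|g| - |f|) ⊔ 0, ?_, ?_, ?_, ?_, ?_⟩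
  · ext t
    rcases le_total (|f t|) (|g t|) with h | h <;> simp [h]
  · exact mem_of_abs_le h₁ hf₁ fun t => by simpa using (key (f t) (g t)).1
  · exact fun h => hf₂ (mem_of_abs_le_add h₂ h hg₂ fun t => by
      simpa using (key (f t) (g t)).2)
  · exact mem_of_abs_le h₂ hg₂ fun t => by simpa using (key (g t) (f t)).1
  · exact fun h => hg₁ (mem_of_abs_le_add h₁ h hf₁ fun t => by
      simpa using (key (g t) (f t)).2)

/-- The primes of `C(T)` containing a fixed prime form a chain. -/
theorem le_or_le_of_prime_le {p q₁ q₂ : Ideal C(T, ℝ)} (hp : p.IsPrime) (h₁ : q₁.IsPrime)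
    (h₂ : q₂.IsPrime) (hp₁ : p ≤ q₁) (hp₂ : p ≤ q₂) : q₁ ≤ q₂ ∨ q₂ ≤ q₁ := by
  by_contra! h
  obtain ⟨f, g, hfg, -, hf₂, -, hg₁⟩ := exists_mul_eq_zero_of_not_le h₁ h₂ h.1 h.2
  rcases hp.mem_or_mem (hfg ▸ p.zero_mem : f * g ∈ p) with h | h
  exacts [hf₂ (hp₂ h), hg₁ (hp₁ h)]

/-- A continuous function vanishing at `0`, all of whose powers dominate a multiple of the
square root on `[0, 1]`. -/
theorem exists_slow_function : ∃ σ : C(ℝ, ℝ), σ 0 = 0 ∧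
    ∀ n : ℕ, ∃ c > 0, ∀ x, 0 ≤ x → x ≤ 1 → c * √x ≤ σ x ^ n := by
  have hpos : ∀ x : ℝ, 0 ≤ max (min x 1) 0 := fun x => le_max_right _ _
  have hle : ∀ x : ℝ, max (min x 1) 0 ≤ 1 := fun x =>
    max_le (min_le_right _ _) zero_le_one
  let F : ℕ → ℝ → ℝ := fun k x =>
    (1 / 2) ^ k * max (min x 1) 0 ^ (1 / (2 * ((k : ℝ) + 1)))
  have hF0 : ∀ k x, 0 ≤ F k x := fun k x =>
    mul_nonneg (by positivity) (Real.rpow_nonneg (hpos x) _)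
  have hF : ∀ k x, F k x ≤ (1 / 2) ^ k := fun k x =>
    mul_le_of_le_one_right (by positivity)
      (Real.rpow_le_one (hpos x) (hle x) (by positivity))
  have hsum : ∀ x, Summable fun k => F k x := fun x =>
    Summable.of_nonneg_of_le (fun k => hF0 k x) (fun k => hF k x) summable_geometric_two
  have hcont : Continuous fun x => ∑' k, F k x := by
    refine continuous_tsum (fun k => ?_) summable_geometric_two (fun k x => ?_)
    · refine continuous_const.mul (Continuous.rpow_const (by fun_prop) fun x => Or.inr ?_)
      positivity
    · rw [Real.norm_of_nonneg (hF0 k x)]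
      exact hF k x
  refine ⟨⟨_, hcont⟩, ?_, fun n => ⟨((1 / 2) ^ n) ^ n, by positivity, fun x hx0 hx1 => ?_⟩⟩
  · have : ∀ k : ℕ, F k 0 = 0 := fun k => by
      have : (1 / (2 * ((k : ℝ) + 1))) ≠ 0 := by positivity
      simp only [F]
      rw [min_eq_left zero_le_one, max_self, Real.zero_rpow this, mul_zero]
    simp [this]
  · have hFn : F n x ≤ ∑' k, F k x := (hsum x).le_tsum n fun k _ => hF0 k x
    have hroot : √x ≤ (x ^ (1 / (2 * ((n : ℝ) + 1)))) ^ n := by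
      rw [← Real.rpow_mul_natCast hx0, Real.sqrt_eq_rpow]
      refine Real.rpow_le_rpow_of_exponent_ge' hx0 hx1 (by positivity) ?_
      rw [div_mul_eq_mul_div, div_le_div_iff₀ (by positivity) (by positivity)]
      linarith
    calc ((1 / 2) ^ n) ^ n * √x ≤ F n x ^ n := by
          simp only [F]
          rw [min_eq_left hx1, max_eq_left hx0, mul_pow]
          exact mul_le_mul_of_nonneg_left hroot (by positivity)
      _ ≤ (∑' k, F k x) ^ n := pow_le_pow_left₀ (hF0 n x) hFn n

/-- Between two primes `p ≤ r` of `C(T)` separated by a function `j`, there is a prime which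
contains `j` but is not closed under replacing `j` by functions with the same zero set. -/
theorem exists_prime_slow_notMem {p r : Ideal C(T, ℝ)} (hp : p.IsPrime) (hr : r.IsPrime)
    (hpr : p ≤ r) {j : C(T, ℝ)} (hj0 : ∀ t, 0 ≤ j t) (hj1 : ∀ t, j t ≤ 1) (hjp : j ∉ p)
    (hjr : j ∈ r) :
    ∃ m : Ideal C(T, ℝ), m.IsPrime ∧ p ≤ m ∧ m ≤ r ∧ j ∈ m ∧
      ∃ s : C(T, ℝ), s ∉ m ∧ ∀ t, j t = 0 → s t = 0 := by
  obtain ⟨σ, hσ0, hσ⟩ := exists_slow_function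
  let s : C(T, ℝ) := σ.comp j
  have hsj : ∀ t, j t = 0 → s t = 0 := fun t ht => by simp [s, ht, hσ0]
  have hdisj : Disjoint ((p ⊔ Ideal.span {j} : Ideal C(T, ℝ)) : Set C(T, ℝ))
      (Submonoid.powers s) := by
    rw [Set.disjoint_left]
    rintro _ hmem ⟨n, rfl⟩
    obtain ⟨a, ha, d, hd, had⟩ := Submodule.mem_sup.1 hmem
    obtain ⟨b, rfl⟩ := Ideal.mem_span_singleton'.1 hd
    obtain ⟨c, hc, hcn⟩ := hσ n
    let k : C(T, ℝ) := ⟨fun t => √(j t), j.continuous.sqrt⟩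
    have hkk : k * k = j := by
      ext t
      exact Real.mul_self_sqrt (hj0 t)
    have hk0 : ∀ t, 0 ≤ k t := fun t => Real.sqrt_nonneg _
    have hkp : k ∉ p := fun h => hjp (hkk ▸ p.mul_mem_left k h)
    have hkr : k ∈ r := (hr.mem_or_mem (hkk.symm ▸ hjr : k * k ∈ r)).elim id id
    let e : C(T, ℝ) := (ContinuousMap.const T c - b * k) ⊔ 0
    have hek : k * e ∈ p := by
      refine mem_of_abs_le hp ha fun t => ?_
      have h1 : a t + b t * j t = s t ^ n := by
        simpa using congrArg (fun g : C(T, ℝ) => g t) had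
      have h2 : c * k t ≤ s t ^ n := hcn (j t) (hj0 t) (hj1 t)
      have h3 : k t * k t = j t := by
        simpa using congrArg (fun g : C(T, ℝ) => g t) hkk
      have h4 : (k * e) t = k t * max (c - b t * k t) 0 := by simp [e]
      rw [h4, abs_of_nonneg (mul_nonneg (hk0 t) (le_max_right _ _))]
      rcases max_cases (c - b t * k t) 0 with ⟨h, -⟩ | ⟨h, -⟩ <;> rw [h]
      · refine le_trans ?_ (le_abs_self _)
        rw [← h3] at h1
        linarith
      · simp
    have her : e ∈ r := hpr ((hp.mem_or_mem hek).resolve_left hkp)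
    have hcr : ContinuousMap.const T c ∈ r := by
      refine mem_of_abs_le_add hr her (r.mul_mem_left b hkr) fun t => ?_
      have h1 : e t = max (c - b t * k t) 0 := by simp [e]
      have h2 : (b * k) t = b t * k t := rfl
      rw [h1, h2, ContinuousMap.const_apply, abs_of_pos hc, abs_of_nonneg (le_max_right _ _)]
      linarith [le_max_left (c - b t * k t) 0, le_abs_self (b t * k t)]
    refine hr.ne_top (r.eq_top_of_isUnit_mem hcr ?_)
    refine IsUnit.of_mul_eq_one (ContinuousMap.const T c⁻¹) ?_
    ext t
    simp [hc.ne']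
  obtain ⟨m, hm, hle, hms⟩ := Ideal.exists_le_prime_disjoint _ _ hdisj
  have hsm : s ∉ m := fun h => Set.disjoint_left.1 hms h (Submonoid.mem_powers s)
  by_cases hsr : s ∈ r
  · have hpm : p ≤ m := le_sup_left.trans hle
    refine ⟨m, hm, hpm, ?_, hle (Ideal.mem_sup_right (Ideal.mem_span_singleton_self j)), s,
      hsm, hsj⟩
    exact (le_or_le_of_prime_le hp hm hr hpm hpr).resolve_right fun h => hsm (h hsr)
  · exact ⟨r, hr, hpr, le_rfl, hjr, s, hsr, hsj⟩

end ContinuousFunctions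

section Ultralimits

open Filter

/-- `P` is the limit of the ultrafilter `𝒰` for the patch topology of the prime spectrum,
pulled back along `φ`. -/
def IsUltralimit {Y R : Type*} [CommRing R] (φ : Y → PrimeSpectrum R) (𝒰 : Ultrafilter Y)
    (P : PrimeSpectrum R) : Prop :=
  ∀ f : R, f ∈ P.asIdeal ↔ ∀ᶠ z in 𝒰, f ∈ (φ z).asIdeal

theorem exists_isUltralimit {Y R : Type*} [CommRing R] (φ : Y → PrimeSpectrum R)
    (𝒰 : Ultrafilter Y) : ∃ P, IsUltralimit φ 𝒰 P := by
  let I : Ideal R :=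
    { carrier := {f | ∀ᶠ z in 𝒰, f ∈ (φ z).asIdeal}
      add_mem' := fun ha hb => by
        filter_upwards [ha, hb] with z h1 h2 using (φ z).asIdeal.add_mem h1 h2
      zero_mem' := Eventually.of_forall fun z => (φ z).asIdeal.zero_mem
      smul_mem' := fun c a ha => by
        filter_upwards [ha] with z h using (φ z).asIdeal.mul_mem_left c h }
  have hI : I.IsPrime := by
    refine ⟨fun h => ?_, fun {a b} hab => ?_⟩
    · obtain ⟨z, hz⟩ := Eventually.exists ((Ideal.eq_top_iff_one I).1 h)
      exact (φ z).isPrime.one_notMem hz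
    · refine Ultrafilter.eventually_or.1 ?_
      filter_upwards [hab] with z hz using (φ z).isPrime.mem_or_mem hz
  exact ⟨⟨I, hI⟩, fun f => Iff.rfl⟩

variable {T Y : Type*} [TopologicalSpace T]

theorem exists_eq_of_mem_qcop [t : TopologicalSpace Y] {φ : Y → PrimeSpectrum C(T, ℝ)}
    (hφ : IsInducing φ) {U : Set Y} (hU : U ∈ qcop t) :
    ∃ f : C(T, ℝ), U = {y | f ∉ (φ y).asIdeal} := by
  obtain ⟨hopen, hcomp⟩ := hU
  suffices ∃ f : C(T, ℝ), U ⊆ {y | f ∉ (φ y).asIdeal} ∧ {y | f ∉ (φ y).asIdeal} ⊆ U by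
    obtain ⟨f, h1, h2⟩ := this
    exact ⟨f, h1.antisymm h2⟩
  refine hcomp.induction_on
    (p := fun S => ∃ f : C(T, ℝ), S ⊆ {y | f ∉ (φ y).asIdeal} ∧ {y | f ∉ (φ y).asIdeal} ⊆ U)
    ⟨0, by simp, by simp⟩ ?_ ?_ ?_
  · rintro S S' hSS' ⟨f, h1, h2⟩
    exact ⟨f, hSS'.trans h1, h2⟩
  · rintro S S' ⟨f, hf, hfU⟩ ⟨g, hg, hgU⟩
    have key : ∀ y, f ^ 2 + g ^ 2 ∈ (φ y).asIdeal ↔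
        f ∈ (φ y).asIdeal ∧ g ∈ (φ y).asIdeal := by
      intro y
      have hp := (φ y).isPrime
      refine ⟨fun h => ⟨?_, ?_⟩, fun h => ?_⟩
      · refine hp.mem_of_pow_mem 2 (mem_of_abs_le hp h fun t => ?_)
        simpa [abs_of_nonneg (add_nonneg (sq_nonneg (f t)) (sq_nonneg (g t)))]
          using sq_nonneg (g t)
      · refine hp.mem_of_pow_mem 2 (mem_of_abs_le hp h fun t => ?_)
        simpa [abs_of_nonneg (add_nonneg (sq_nonneg (f t)) (sq_nonneg (g t)))]
          using sq_nonneg (f t)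
      · exact Ideal.add_mem _ (Ideal.pow_mem_of_mem _ h.1 2 two_pos)
          (Ideal.pow_mem_of_mem _ h.2 2 two_pos)
    refine ⟨f ^ 2 + g ^ 2, ?_, fun y hy => ?_⟩
    · rintro y (hy | hy) h
      exacts [hf hy ((key y).1 h).1, hg hy ((key y).1 h).2]
    · by_cases hfy : f ∈ (φ y).asIdeal
      · exact hgU fun hgy => hy ((key y).2 ⟨hfy, hgy⟩)
      · exact hfU hfy
  · intro y hy
    obtain ⟨V, hV, rfl⟩ := hφ.isOpen_iff.1 hopen
    obtain ⟨_, ⟨f, rfl⟩, hfy, hfV⟩ :=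
      PrimeSpectrum.isTopologicalBasis_basic_opens.exists_subset_of_mem_open
        (show φ y ∈ V from hy) hV
    refine ⟨_, mem_nhdsWithin_of_mem_nhds
      ((PrimeSpectrum.isOpen_basicOpen.preimage hφ.continuous).mem_nhds hfy), f,
      fun z hz => hz, fun z hz => hfV hz⟩

theorem mem_of_isClosed_patchTop [t : TopologicalSpace Y] {φ : Y → PrimeSpectrum C(T, ℝ)}
    (hφ : IsInducing φ) {S : Set Y} (hS : IsClosed[patchTop t] S) {𝒰 : Ultrafilter Y}
    (hSU : S ∈ 𝒰) {y : Y} (hy : IsUltralimit φ 𝒰 (φ y)) : y ∈ S := by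
  have key : ∀ U, IsOpen[patchTop t] U → y ∈ U → U ∈ 𝒰 := by
    intro U hU
    induction hU with
    | basic U hU =>
      intro hyU
      rcases hU with hU | ⟨U, hU, rfl⟩
      · obtain ⟨f, rfl⟩ := exists_eq_of_mem_qcop hφ hU
        exact Ultrafilter.eventually_not.2 fun h => hyU ((hy f).2 h)
      · obtain ⟨f, rfl⟩ := exists_eq_of_mem_qcop hφ hU
        filter_upwards [(hy f).1 (not_not.1 hyU)] with z hz using not_not.2 hz
    | univ => exact fun _ => univ_mem
    | inter U V _ _ hU hV => exact fun h => inter_mem (hU h.1) (hV h.2)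
    | sUnion 𝒮 _ ih =>
      rintro ⟨U, hU, hyU⟩
      exact mem_of_superset (ih U hU hyU) (subset_sUnion_of_mem hU)
  by_contra hyS
  exact Ultrafilter.compl_notMem_iff.2 hSU (key Sᶜ hS.isOpen_compl hyS)

end Ultralimits

section PatchClosedSubsets

open Filter

variable {T : Type*} [TopologicalSpace T] {X : Set (PrimeSpectrum C(T, ℝ))}

theorem exists_isUltralimit_subtype (hX : IsClosed[patchTop (specTop T)] X)
    (𝒰 : Ultrafilter X) :
    ∃ x : X, IsUltralimit (Subtype.val : X → PrimeSpectrum C(T, ℝ)) 𝒰 x := by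
  obtain ⟨P, hP⟩ := exists_isUltralimit Subtype.val 𝒰
  have hPX : P ∈ X := mem_of_isClosed_patchTop (t := specTop T) (𝒰 := 𝒰.map Subtype.val)
    IsInducing.id hX (Ultrafilter.mem_map.2 (mem_of_superset univ_mem fun x _ => x.2)) hP
  exact ⟨⟨P, hPX⟩, hP⟩

theorem specLE_subTop_iff {x y : X} : specLE (subTop X) x y ↔ x ≤ y := by
  change y ∈ closure {x} ↔ _
  rw [← specializes_iff_mem_closure, ← IsInducing.subtypeVal.specializes_iff,
    ← PrimeSpectrum.le_iff_specializes]
  rfl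

theorem mem_minPts_subTop_iff {x : X} : x ∈ minPts (subTop X) ↔ ∀ y ≤ x, y = x :=
  forall_congr' fun _ => by rw [specLE_subTop_iff]

theorem isOpen_setOf_notMem (f : C(T, ℝ)) : IsOpen {x : X | f ∉ x.1.asIdeal} :=
  (PrimeSpectrum.isOpen_basicOpen (a := f)).preimage continuous_subtype_val

theorem IsOpen.mem_of_le_of_mem {U : Set X} (hU : IsOpen U) {x y : X} (hxy : x ≤ y)
    (hy : y ∈ U) : x ∈ U :=
  (specializes_iff_mem_closure.2 (specLE_subTop_iff.2 hxy)).mem_open hU hy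

theorem exists_subset_of_mem_isOpen {U : Set X} (hU : IsOpen U) {x : X} (hx : x ∈ U) :
    ∃ f : C(T, ℝ), f ∉ x.1.asIdeal ∧ {y : X | f ∉ y.1.asIdeal} ⊆ U := by
  obtain ⟨V, hV, rfl⟩ := isOpen_induced_iff.1 hU
  obtain ⟨_, ⟨f, rfl⟩, hfx, hfV⟩ :=
    PrimeSpectrum.isTopologicalBasis_basic_opens.exists_subset_of_mem_open hx hV
  exact ⟨f, hfx, fun y hy => hfV hy⟩

theorem setOf_notMem_mem_qcop (hX : IsClosed[patchTop (specTop T)] X) (f : C(T, ℝ)) :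
    {x : X | f ∉ x.1.asIdeal} ∈ qcop (subTop X) := by
  refine ⟨isOpen_setOf_notMem f, isCompact_iff_ultrafilter_le_nhds'.2 fun 𝒰 h𝒰 => ?_⟩
  obtain ⟨x, hx⟩ := exists_isUltralimit_subtype hX 𝒰
  refine ⟨x, fun h => Ultrafilter.eventually_not.1 h𝒰 ((hx f).1 h), fun V hV => ?_⟩
  obtain ⟨W, hWV, hW, hxW⟩ := mem_nhds_iff.1 hV
  obtain ⟨g, hgx, hgW⟩ := exists_subset_of_mem_isOpen hW hxW
  filter_upwards [Ultrafilter.eventually_not.2 (mt (hx g).2 hgx)] with y hy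
    using hWV (hgW hy)

theorem isClopen_mem_qcop (hX : IsClosed[patchTop (specTop T)] X) {U : Set X}
    (hU : IsClopen U) : U ∈ qcop (subTop X) := by
  have huniv : IsCompact {x : X | (1 : C(T, ℝ)) ∉ x.1.asIdeal} :=
    (setOf_notMem_mem_qcop hX 1).2
  exact ⟨hU.isOpen, huniv.of_isClosed_subset hU.isClosed
    fun x _ => x.1.isPrime.one_notMem⟩

/-- The closure of a set which is closed under ultralimits consists of its
specializations. -/
theorem exists_le_of_mem_closure (hX : IsClosed[patchTop (specTop T)] X) {S : Set X}
    (hS : ∀ (𝒰 : Ultrafilter X) (x : X), S ∈ 𝒰 → IsUltralimit Subtype.val 𝒰 x.1 → x ∈ S)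
    {x : X} (hx : x ∈ closure S) : ∃ y ∈ S, y ≤ x := by
  obtain ⟨𝒰, hS𝒰, h𝒰⟩ := mem_closure_iff_ultrafilter.1 hx
  obtain ⟨y, hy⟩ := exists_isUltralimit_subtype hX 𝒰
  refine ⟨y, hS 𝒰 y hS𝒰 hy, fun f hf => ?_⟩
  by_contra hfx
  exact Ultrafilter.eventually_not.1 (h𝒰 ((isOpen_setOf_notMem f).mem_nhds hfx)) ((hy f).1 hf)

theorem exists_mem_minPts_le (hX : IsClosed[patchTop (specTop T)] X) (x : X) :
    ∃ y ∈ minPts (subTop X), y ≤ x := by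
  have hchain : ∀ c ⊆ (univ : Set Xᵒᵈ), IsChain (· ≤ ·) c → ∀ y ∈ c,
      ∃ b ∈ (univ : Set Xᵒᵈ), ∀ z ∈ c, z ≤ b := by
    intro c _ hc y hy
    have : Nonempty c := ⟨⟨y, hy⟩⟩
    have : Nonempty X := ⟨x⟩
    let F : Filter X := ⨅ z : c, 𝓟 (Iic (OrderDual.ofDual z.1))
    have hF : F.NeBot := by
      refine iInf_neBot_of_directed (fun a b => ?_) fun z =>
        principal_neBot_iff.2 nonempty_Iic
      rcases hc.total a.2 b.2 with h | h
      · exact ⟨b, principal_mono.2 (Iic_subset_Iic.2 h), le_rfl⟩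
      · exact ⟨a, le_rfl, principal_mono.2 (Iic_subset_Iic.2 h)⟩
    obtain ⟨w, hw⟩ := exists_isUltralimit_subtype hX (Ultrafilter.of F)
    refine ⟨OrderDual.toDual w, mem_univ _, fun z hz f hf => ?_⟩
    have hz' : ∀ᶠ v in Ultrafilter.of F, v ≤ OrderDual.ofDual z :=
      Ultrafilter.of_le F (mem_iInf_of_mem (⟨z, hz⟩ : c) (mem_principal_self _))
    obtain ⟨v, hvz, hv⟩ := (hz'.and ((hw f).1 hf)).exists
    exact hvz hv
  obtain ⟨m, hxm, hm⟩ := zorn_le_nonempty₀ univ hchain (OrderDual.toDual x) (mem_univ _)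
  exact ⟨OrderDual.ofDual m, mem_minPts_subTop_iff.2 fun y hy =>
    le_antisymm hy (hm.2 (mem_univ (OrderDual.toDual y)) hy), hxm⟩

theorem stoneAlgebra_of_isClosed_minPts (hX : IsClosed[patchTop (specTop T)] X)
    (hmin : IsClosed[patchTop (subTop X)] (minPts (subTop X)))
    (hstr : Stranded (subTop X)) : StoneAlgebra (qcop (subTop X)) := by
  suffices h : ∀ U ∈ qcop (subTop X), ∃ A B, IsPseudoCompl (qcop (subTop X)) U B ∧
      IsPseudoCompl (qcop (subTop X)) B A ∧ B ∪ A = univ by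
    have huniq : ∀ {U V W : Set X}, IsPseudoCompl (qcop (subTop X)) U V →
        IsPseudoCompl (qcop (subTop X)) U W → V = W := fun hV hW =>
      (hW.2.2 _ hV.1 hV.2.1).antisymm (hV.2.2 _ hW.1 hW.2.1)
    refine ⟨fun U hU => ?_, fun U hU V W hV hW => ?_⟩
    · obtain ⟨A, B, hB, -⟩ := h U hU
      exact ⟨B, hB⟩
    · obtain ⟨A, B, hB, hA, hAB⟩ := h U hU
      obtain rfl := huniq hV hB
      obtain rfl := huniq hW hA
      exact hAB
  intro U hU
  obtain ⟨f, hf⟩ := exists_eq_of_mem_qcop (t := subTop X) IsInducing.subtypeVal hU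
  have hUopen : IsOpen U := hU.1
  have hminlim : ∀ (𝒰 : Ultrafilter X) (x : X), minPts (subTop X) ∈ 𝒰 →
      IsUltralimit Subtype.val 𝒰 x.1 → x ∈ minPts (subTop X) := fun 𝒰 x h𝒰 hx =>
    mem_of_isClosed_patchTop (t := subTop X) IsInducing.subtypeVal hmin h𝒰 hx
  let A : Set X := {x | ∃ y ∈ minPts (subTop X) ∩ U, y ≤ x}
  let B : Set X := {x | ∃ y ∈ minPts (subTop X) ∩ Uᶜ, y ≤ x}
  have hup : ∀ S : Set X,
      (∀ (𝒰 : Ultrafilter X) (x : X), S ∈ 𝒰 → IsUltralimit Subtype.val 𝒰 x.1 → x ∈ S) →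
      IsClosed {x : X | ∃ y ∈ S, y ≤ x} := by
    intro S hS
    refine isClosed_of_closure_subset fun x hx => exists_le_of_mem_closure hX hS ?_
    refine closure_minimal (fun z hz => ?_) isClosed_closure hx
    obtain ⟨y, hy, hyz⟩ := hz
    exact closure_mono (singleton_subset_iff.2 hy) (specLE_subTop_iff.2 hyz)
  have hA : IsClosed A := by
    refine hup _ fun 𝒰 x h𝒰 hx => ⟨hminlim 𝒰 x (mem_of_superset h𝒰 inter_subset_left) hx, ?_⟩
    have h𝒰U := mem_of_superset h𝒰 inter_subset_right
    rw [hf] at h𝒰U ⊢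
    exact fun h => Ultrafilter.eventually_not.1 h𝒰U ((hx f).1 h)
  have hB : IsClosed B := by
    refine hup _ fun 𝒰 x h𝒰 hx => ⟨hminlim 𝒰 x (mem_of_superset h𝒰 inter_subset_left) hx, ?_⟩
    have h𝒰U := mem_of_superset h𝒰 inter_subset_right
    rw [hf] at h𝒰U ⊢
    exact not_not.2 ((hx f).2 (by filter_upwards [h𝒰U] with z hz using not_not.1 hz))
  have hAB : B = Aᶜ := by
    refine Subset.antisymm ?_ fun x hx => ?_
    · rintro x ⟨y, ⟨hy, hyU⟩, hyx⟩ ⟨z, ⟨hz, hzU⟩, hzx⟩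
      have hyz : y ≠ z := fun h => hyU (h ▸ hzU)
      rcases hstr x (Or.inr (specLE_subTop_iff.2 hyx)) (Or.inr (specLE_subTop_iff.2 hzx)) hyz
        with h | h
      exacts [hyz (hz y h), hyz (hy z h).symm]
    · obtain ⟨y, hy, hyx⟩ := exists_mem_minPts_le hX x
      exact ⟨y, ⟨hy, fun hyU => hx ⟨y, ⟨hy, hyU⟩, hyx⟩⟩, hyx⟩
  have hAclopen : IsClopen A := ⟨hA, by
    rw [← isClosed_compl_iff, ← hAB]
    exact hB⟩
  refine ⟨A, B, ⟨hAB ▸ isClopen_mem_qcop hX hAclopen.compl, ?_, fun W hW hUW x hx => ?_⟩,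
    ⟨isClopen_mem_qcop hX hAclopen, by rw [hAB, compl_inter_self], fun W _ hBW => ?_⟩,
    by rw [hAB, compl_union_self]⟩
  · refine eq_empty_iff_forall_notMem.2 ?_
    rintro x ⟨hxU, y, ⟨-, hyU⟩, hyx⟩
    exact hyU (hUopen.mem_of_le_of_mem hyx hxU)
  · rw [hAB]
    rintro ⟨y, ⟨-, hyU⟩, hyx⟩
    have hWopen : IsOpen W := hW.1
    exact eq_empty_iff_forall_notMem.1 hUW y ⟨hyU, hWopen.mem_of_le_of_mem hyx hx⟩
  · rw [hAB, inter_comm, ← disjoint_iff_inter_eq_empty, disjoint_compl_right_iff_subset] at hBW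
    exact hBW

theorem isClosed_patchTop_of_mem_qcop {Y : Type*} {t : TopologicalSpace Y} {U : Set Y}
    (hU : U ∈ qcop t) : IsClosed[patchTop t] U :=
  (@isOpen_compl_iff _ _ (patchTop t)).1
    (TopologicalSpace.isOpen_generateFrom_of_mem (Or.inr ⟨U, hU, rfl⟩))

theorem isClosed_minPts_of_isPCSpace (hX : IsClosed[patchTop (specTop T)] X)
    (hPC : IsPCSpace (subTop X)) : IsClosed[patchTop (subTop X)] (minPts (subTop X)) := by
  have : minPts (subTop X) = ⋂ p : {p : Set X × Set X // p.1 ∈ qcop (subTop X) ∧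
      IsPseudoCompl (qcop (subTop X)) p.1 p.2}, p.1.1 ∪ p.1.2 := by
    ext x
    rw [mem_iInter, mem_minPts_subTop_iff]
    constructor
    · rintro hx ⟨⟨U, V⟩, hU, hV⟩
      by_contra hxUV
      obtain ⟨hxU, hxV⟩ := not_or.1 hxUV
      obtain ⟨f, rfl⟩ := exists_eq_of_mem_qcop (t := subTop X) IsInducing.subtypeVal hU
      have hxcl : x ∉ closure {y : X | f ∉ y.1.asIdeal} := fun h => by
        obtain ⟨y, hy, hyx⟩ := exists_le_of_mem_closure hX (fun 𝒰 z h𝒰 hz hfz =>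
          Ultrafilter.eventually_not.1 h𝒰 ((hz f).1 hfz)) h
        exact hxU (hx y hyx ▸ hy)
      obtain ⟨g, hgx, hg⟩ := exists_subset_of_mem_isOpen isClosed_closure.isOpen_compl hxcl
      refine hxV (hV.2.2 _ (setOf_notMem_mem_qcop hX g) ?_ hgx)
      exact eq_empty_iff_forall_notMem.2 fun y hy => hg hy.2 (subset_closure hy.1)
    · intro h y hyx
      by_contra hne
      obtain ⟨f, hfx, hfy⟩ := SetLike.not_le_iff_exists.1 fun hxy : x.1.asIdeal ≤ y.1.asIdeal =>
        hne (le_antisymm hyx hxy)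
      have hU := setOf_notMem_mem_qcop hX f
      obtain ⟨V, hV⟩ := hPC _ hU
      have hVopen : IsOpen V := hV.1.1
      rcases h ⟨⟨_, V⟩, hU, hV⟩ with hx | hx
      · exact hx hfx
      · exact eq_empty_iff_forall_notMem.1 hV.2.1 y ⟨hfy, hVopen.mem_of_le_of_mem hyx hx⟩
  rw [this]
  refine @isClosed_iInter _ _ (patchTop (subTop X)) _ fun p => ?_
  refine @IsClosed.union _ _ _ (patchTop (subTop X)) ?_ ?_
  · exact isClosed_patchTop_of_mem_qcop p.2.1
  · exact isClosed_patchTop_of_mem_qcop p.2.2.1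

/-- In a convex PC-subspace of `Spec C(T)`, the generalizations of a point form a chain. -/
theorem le_or_le_of_le_of_isPCSpace (hX : IsClosed[patchTop (specTop T)] X)
    (hconv : ∀ p q r : PrimeSpectrum C(T, ℝ),
      p.asIdeal ≤ q.asIdeal → q.asIdeal ≤ r.asIdeal → p ∈ X → r ∈ X → q ∈ X)
    (hPC : IsPCSpace (subTop X)) {p q r : X} (hpr : p ≤ r) (hqr : q ≤ r) :
    p ≤ q ∨ q ≤ p := by
  by_contra! hpq
  obtain ⟨f, g, hfg, hfp, hfq, hgq, hgp⟩ := exists_mul_eq_zero_of_not_le p.1.isPrime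
    q.1.isPrime hpq.1 hpq.2
  obtain ⟨V, hV, hUV, hVmax⟩ := hPC _ (setOf_notMem_mem_qcop hX f)
  have hpV : p ∈ V := hVmax _ (setOf_notMem_mem_qcop hX g) (by
    refine eq_empty_iff_forall_notMem.2 fun x hx => ?_
    rcases x.1.isPrime.mem_or_mem (hfg ▸ Ideal.zero_mem _ : f * g ∈ x.1.asIdeal) with h | h
    exacts [hx.1 h, hx.2 h]) hgp
  obtain ⟨h, rfl⟩ := exists_eq_of_mem_qcop (t := subTop X) IsInducing.subtypeVal hV
  have hfh : ∀ x : X, f ∉ x.1.asIdeal → h ∈ x.1.asIdeal := fun x hfx => by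
    by_contra hhx
    exact eq_empty_iff_forall_notMem.1 hUV x ⟨hfx, hhx⟩
  let j : C(T, ℝ) := ((|h| - |f|) ⊔ 0) ⊓ 1
  let e : C(T, ℝ) := (|f| - |h|) ⊔ 0
  have hj : ∀ t, j t = min (max (|h t| - |f t|) 0) 1 := fun t => by simp [j]
  have he : ∀ t, e t = max (|f t| - |h t|) 0 := fun t => by simp [e]
  have hj0 : ∀ t, 0 ≤ j t := fun t => by
    rw [hj]
    exact le_min (le_max_right _ _) zero_le_one
  have hj1 : ∀ t, j t ≤ 1 := fun t => by
    rw [hj]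
    exact min_le_right _ _
  have hmem : ∀ I : Ideal C(T, ℝ), I.IsPrime → f ∈ I → j ∈ I → h ∈ I := by
    intro I hI hfI hjI
    refine mem_of_abs_le_add hI hfI (I.mul_mem_left (1 + |h|) hjI) fun t => ?_
    have h1 : ((1 + |h|) * j) t = (1 + |h t|) * j t := by simp
    have h2 : |h t| - |f t| ≤ (1 + |h t|) * j t := by
      have hf0 := abs_nonneg (f t)
      have hh0 := abs_nonneg (h t)
      rw [hj]
      rcases min_cases (max (|h t| - |f t|) 0) 1 with ⟨hm, -⟩ | ⟨hm, -⟩ <;> rw [hm]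
      · have := le_max_left (|h t| - |f t|) 0
        have := mul_nonneg hh0 (le_max_right (|h t| - |f t|) 0)
        linarith
      · linarith
    rw [h1]
    linarith [le_abs_self ((1 + |h t|) * j t)]
  have hjp : j ∉ p.1.asIdeal := fun hjp => hpV (hmem _ p.1.isPrime hfp hjp)
  have hjr : j ∈ r.1.asIdeal := by
    refine mem_of_abs_le r.1.isPrime (hqr (hfh q hfq)) fun t => ?_
    rw [abs_of_nonneg (hj0 t), hj]
    exact (min_le_left _ _).trans
      (max_le (by linarith [abs_nonneg (f t)]) (abs_nonneg _))
  obtain ⟨m, hm, hpm, hmr, hjm, s, hsm, hs⟩ := exists_prime_slow_notMem p.1.isPrime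
    r.1.isPrime hpr hj0 hj1 hjp hjr
  let x : X := ⟨⟨m, hm⟩, hconv p.1 ⟨m, hm⟩ r.1 hpm hmr p.2 r.2⟩
  have hhx : h ∈ x.1.asIdeal := hmem m hm (hpm hfp) hjm
  have hxcl : x ∈ closure {y : X | f ∉ y.1.asIdeal} := by
    by_contra hxcl
    obtain ⟨g, hgx, hg⟩ := exists_subset_of_mem_isOpen isClosed_closure.isOpen_compl hxcl
    refine hVmax _ (setOf_notMem_mem_qcop hX g) ?_ hgx hhx
    exact eq_empty_iff_forall_notMem.2 fun y hy => hg hy.2 (subset_closure hy.1)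
  obtain ⟨y, hfy, hyx⟩ := exists_le_of_mem_closure hX (fun 𝒰 z h𝒰 hz hfz =>
    Ultrafilter.eventually_not.1 h𝒰 ((hz f).1 hfz)) hxcl
  have hey : e ∉ y.1.asIdeal := fun hey => hfy <| by
    refine mem_of_abs_le_add y.1.isPrime hey (hfh y hfy) fun t => ?_
    rw [he]
    linarith [le_max_left (|f t| - |h t|) 0, le_abs_self (max (|f t| - |h t|) 0)]
  have hes : e * s = 0 := by
    ext t
    rcases le_total (|f t|) (|h t|) with hle | hle
    · simp [he, hle]
    · simp [hs t (by simp [hj, hle])]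
  exact hsm (hyx ((y.1.isPrime.mem_or_mem (hes ▸ Ideal.zero_mem _ :
    e * s ∈ y.1.asIdeal)).resolve_left hey))

theorem stranded_of_isPCSpace (hX : IsClosed[patchTop (specTop T)] X)
    (hconv : ∀ p q r : PrimeSpectrum C(T, ℝ),
      p.asIdeal ≤ q.asIdeal → q.asIdeal ≤ r.asIdeal → p ∈ X → r ∈ X → q ∈ X)
    (hPC : IsPCSpace (subTop X)) : Stranded (subTop X) := by
  intro x a ha b hb _
  simp only [mem_ofPred_eq, specLE_subTop_iff] at ha hb ⊢
  rcases ha with ha | ha <;> rcases hb with hb | hb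
  · exact le_or_le_of_prime_le x.1.isPrime a.1.isPrime b.1.isPrime ha hb
  · exact Or.inr (hb.trans ha)
  · exact Or.inl (ha.trans hb)
  · exact le_or_le_of_le_of_isPCSpace hX hconv hPC ha hb

end PatchClosedSubsets

/-- Let `T` be completely regular Hausdorff and let `X ⊆ Spec C(T)` be
patch closed and convex for specialization, regarded as a spectral space with the
subspace topology. TFAE: (i) `X` is a PC-space; (ii) `qcop X` is a Stone algebra;
(iii) `X^min` is patch closed and `X` is stranded. -/
theorem statement_13 {T : Type*} [TopologicalSpace T] [CompletelyRegularSpace T]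
    [T2Space T] (X : Set (PrimeSpectrum (ContinuousMap T ℝ)))
    (hpatch : IsClosed[patchTop (specTop T)] X)
    (hconv : ∀ p q r : PrimeSpectrum (ContinuousMap T ℝ),
      p.asIdeal ≤ q.asIdeal → q.asIdeal ≤ r.asIdeal → p ∈ X → r ∈ X → q ∈ X) :
    List.TFAE
      [ IsPCSpace (subTop X),
        StoneAlgebra (qcop (subTop X)),
        IsClosed[patchTop (subTop X)] (minPts (subTop X)) ∧ Stranded (subTop X) ] := by
  tfae_have 1 → 3 := fun h =>
    ⟨isClosed_minPts_of_isPCSpace hpatch h, stranded_of_isPCSpace hpatch hconv h⟩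
  tfae_have 3 → 2 := fun h => stoneAlgebra_of_isClosed_minPts hpatch h.1 h.2
  tfae_have 2 → 1 := fun h => h.1
  tfae_finish
end

section
/- Let T be a completely regular Hausdorff space and βT its Stone–Čech compactification. Then Spec C(T) is a PC-space if and only if Spec C(βT) is a PC-space; equivalently, qcop(Spec C(T)) is pseudocomplemented if and only if qcop(Spec C*(T)) is pseudocomplemented, where C*(T) is the subring of C(T) consisting of bounded continuous functions. -/
open Set Topology

open PCF

section InverseLog

open Filter Real

/-- A function tending to `0` at `0` more slowly than every root. -/
noncomputable def inverseLog (x : ℝ) : ℝ := (log (min x (1 / 2)))⁻¹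

theorem inverseLog_zero : inverseLog 0 = 0 := by
  simp [inverseLog]

theorem continuousAt_inv_log {x : ℝ} (hx : 0 ≤ x) (hx1 : x < 1) :
    ContinuousAt (fun y => (log y)⁻¹) x := by
  rcases hx.eq_or_lt with rfl | hx
  · rw [continuousAt_iff_punctured_nhds]
    simpa [Pi.inv_def] using tendsto_log_nhdsNE_zero.inv_tendsto_atBot
  · exact (continuousAt_log hx.ne').inv₀ (log_neg hx hx1).ne

theorem continuous_inverseLog_comp {X : Type*} [TopologicalSpace X] {G : X → ℝ}
    (hG : Continuous G) (hG0 : ∀ x, 0 ≤ G x) : Continuous fun x => inverseLog (G x) := by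
  rw [continuous_iff_continuousAt]
  intro x
  have h : ContinuousAt (fun y => min (G y) (1 / 2)) x := by fun_prop
  exact ContinuousAt.comp (f := fun y => min (G y) (1 / 2)) (g := fun y => (log y)⁻¹)
    (continuousAt_inv_log (le_min (hG0 x) (by norm_num))
      (lt_of_le_of_lt (min_le_right _ _) (by norm_num))) h

theorem abs_inverseLog_le {x : ℝ} (hx : 0 ≤ x) : |inverseLog x| ≤ (log 2)⁻¹ := by
  have h2 : 0 < log 2 := log_pos (by norm_num)
  rcases hx.eq_or_lt with rfl | hx
  · simp [inverseLog_zero, h2.le]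
  · have hm : 0 < min x (1 / 2) := lt_min hx (by norm_num)
    have h : log (min x (1 / 2)) ≤ log (1 / 2) := log_le_log hm (min_le_right _ _)
    rw [one_div, log_inv] at h
    rw [inverseLog, abs_inv, one_div]
    apply inv_anti₀ h2
    rw [abs_of_nonpos (by linarith)]
    linarith

theorem tendsto_abs_mul_abs_log_pow (n : ℕ) :
    Tendsto (fun x => |x| * |log x| ^ n) (𝓝 0) (𝓝 0) := by
  have h : ContinuousAt (fun x : ℝ => |x| * |log x| ^ n) 0 := by
    rw [continuousAt_iff_punctured_nhds]
    have h1 : Tendsto (fun x : ℝ => |x|⁻¹) (𝓝[≠] 0) atTop :=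
      tendsto_inv_nhdsGT_zero.comp tendsto_abs_nhdsNE_zero
    have h2 := ((isLittleO_pow_log_id_atTop (n := n)).tendsto_div_nhds_zero.comp h1).abs
    simpa [Function.comp_def, log_inv, abs_mul, abs_div, abs_pow, mul_comm] using h2
  simpa using h.tendsto

/-- If a power of `inverseLog ∘ G` is locally dominated by `G`, then the zero set of `G` is
open. -/
theorem isOpen_zeros_of_inverseLog_pow_le {X : Type*} [TopologicalSpace X] {G K : X → ℝ}
    (hG : Continuous G) (hK : Continuous K) (hG0 : ∀ x, 0 ≤ G x) (n : ℕ)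
    (h : ∀ x, |inverseLog (G x)| ^ n ≤ K x * G x) : IsOpen {x | G x = 0} := by
  rw [isOpen_iff_mem_nhds]
  intro a ha
  have ha : G a = 0 := ha
  have hGa : Tendsto G (𝓝 a) (𝓝 0) := ha ▸ hG.tendsto a
  have hlim : Tendsto (fun x => K x * (|G x| * |log (G x)| ^ n)) (𝓝 a) (𝓝 0) := by
    simpa using (hK.tendsto a).mul ((tendsto_abs_mul_abs_log_pow n).comp hGa)
  filter_upwards [hlim.eventually_lt_const one_pos,
    hGa.eventually_lt_const (show (0 : ℝ) < 1 / 2 by norm_num)] with x h1 h2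
  by_contra hne
  have hpos : 0 < G x := lt_of_le_of_ne (hG0 x) (Ne.symm hne)
  have hlog : log (G x) ≠ 0 := (log_neg hpos (by linarith)).ne
  have hpow : 0 < |log (G x)| ^ n := by positivity
  have h3 := h x
  rw [inverseLog, min_eq_left h2.le, abs_inv, inv_pow, inv_le_iff_one_le_mul₀ hpow] at h3
  rw [abs_of_pos hpos] at h1
  nlinarith

end InverseLog

section SpectrumOfFunctionRing

open PrimeSpectrum

variable {X R : Type*} [TopologicalSpace X] [CommRing R]

theorem isReduced_of_injective_continuousMap {φ : R →+* C(X, ℝ)}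
    (hφ : Function.Injective φ) : IsReduced R := by
  refine ⟨fun r ⟨n, hn⟩ => hφ ?_⟩
  ext x
  have h := congrArg (fun F => F x) (congrArg φ hn)
  rw [map_zero]
  exact eq_zero_of_pow_eq_zero (n := n) (by simpa using h)

theorem basicOpen_inter_eq_empty_iff [IsReduced R] (a b : R) :
    (basicOpen a : Set (PrimeSpectrum R)) ∩ basicOpen b = ∅ ↔ a * b = 0 := by
  rw [← isNilpotent_iff_eq_zero, ← basicOpen_eq_bot_iff, basicOpen_mul,
    ← TopologicalSpace.Opens.coe_eq_empty, TopologicalSpace.Opens.coe_inf]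

theorem basicOpen_subset_compl_zeroLocus {t : Set R} {g : R} (hg : g ∈ t) :
    (basicOpen g : Set (PrimeSpectrum R)) ⊆ (zeroLocus t)ᶜ :=
  fun _ hp hpt => hp (hpt hg)

/-- The sum of the absolute values of finitely many functions. -/
def sumAbs (φ : R →+* C(X, ℝ)) (t : Finset R) (x : X) : ℝ := ∑ g ∈ t, |φ g x|

theorem continuous_sumAbs (φ : R →+* C(X, ℝ)) (t : Finset R) : Continuous (sumAbs φ t) := by
  unfold sumAbs
  fun_prop

theorem sumAbs_nonneg (φ : R →+* C(X, ℝ)) (t : Finset R) (x : X) : 0 ≤ sumAbs φ t x :=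
  Finset.sum_nonneg fun _ _ => abs_nonneg _

theorem sumAbs_eq_zero_iff (φ : R →+* C(X, ℝ)) (t : Finset R) (x : X) :
    sumAbs φ t x = 0 ↔ ∀ g ∈ t, φ g x = 0 := by
  simp [sumAbs, Finset.sum_eq_zero_iff_of_nonneg]

theorem exists_abs_le_mul_sumAbs (φ : R →+* C(X, ℝ)) {t : Finset R} {r : R}
    (hr : r ∈ Ideal.span (t : Set R)) :
    ∃ K : X → ℝ, Continuous K ∧ ∀ x, |φ r x| ≤ K x * sumAbs φ t x := by
  induction hr using Submodule.span_induction with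
  | mem g hg =>
    refine ⟨fun _ => 1, continuous_const, fun x => ?_⟩
    rw [one_mul]
    exact Finset.single_le_sum (f := fun g => |φ g x|) (fun _ _ => abs_nonneg _) hg
  | zero => exact ⟨fun _ => 0, continuous_const, fun x => by simp⟩
  | add a b _ _ iha ihb =>
    obtain ⟨K, hK, ha⟩ := iha
    obtain ⟨L, hL, hb⟩ := ihb
    refine ⟨fun x => K x + L x, hK.add hL, fun x => ?_⟩
    rw [map_add, ContinuousMap.add_apply, add_mul]
    exact (abs_add_le _ _).trans (add_le_add (ha x) (hb x))
  | smul c a _ iha =>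
    obtain ⟨K, hK, ha⟩ := iha
    refine ⟨fun x => |φ c x| * K x, by fun_prop, fun x => ?_⟩
    rw [smul_eq_mul, map_mul, ContinuousMap.mul_apply, abs_mul, mul_assoc]
    exact mul_le_mul_of_nonneg_left (ha x) (abs_nonneg _)

variable {φ : R →+* C(X, ℝ)}

theorem basicallyDisconnected_of_pseudocomplemented [CompletelyRegularSpace X]
    (hφ : Function.Injective φ)
    (hb : ∀ F : C(X, ℝ), (∃ M, ∀ x, |F x| ≤ M) → ∃ r, φ r = F)
    (h : Pseudocomplemented (qcop (inferInstance : TopologicalSpace (PrimeSpectrum R)))) :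
    BasicallyDisconnected X := by
  have := isReduced_of_injective_continuousMap hφ
  intro F
  have hpos (x : X) : 0 < 1 + |F x| := by positivity
  obtain ⟨f, hf⟩ := hb ⟨fun x => F x / (1 + |F x|),
    F.continuous.div (by fun_prop) fun x => (hpos x).ne'⟩ ⟨1, fun x => by
      rw [ContinuousMap.coe_mk, abs_div, abs_of_pos (hpos x), div_le_one (hpos x)]
      linarith⟩
  have hf0 (x : X) : φ f x = 0 ↔ F x = 0 := by
    simp [hf, (hpos x).ne']
  obtain ⟨V, hV, hdisj, hmax⟩ := h (basicOpen f) ⟨(basicOpen f).isOpen, isCompact_basicOpen f⟩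
  obtain ⟨t, rfl⟩ := isCompact_isOpen_iff.1 hV.symm
  have hdom (r : R) (hr : f * r = 0) :
      ∃ n : ℕ, ∃ K : X → ℝ, Continuous K ∧ ∀ x, |φ r x| ^ n ≤ K x * sumAbs φ t x := by
    have hsub := hmax (basicOpen r) ⟨(basicOpen r).isOpen, isCompact_basicOpen r⟩
      ((basicOpen_inter_eq_empty_iff f r).2 hr)
    rw [basicOpen_eq_zeroLocus_compl, Set.compl_subset_compl, ← zeroLocus_span (t : Set R),
      ← zeroLocus_span {r}, zeroLocus_subset_zeroLocus_iff, Ideal.span_singleton_le_iff_mem] at hsub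
    obtain ⟨n, hn⟩ := hsub
    obtain ⟨K, hK, hle⟩ := exists_abs_le_mul_sumAbs φ hn
    exact ⟨n, K, hK, fun x => by simpa [abs_pow] using hle x⟩
  have hann (g : R) (hg : g ∈ t) : f * g = 0 := by
    rw [← basicOpen_inter_eq_empty_iff, ← Set.subset_empty_iff, ← hdisj]
    exact Set.inter_subset_inter_right _ (basicOpen_subset_compl_zeroLocus hg)
  have hG := continuous_sumAbs φ t
  have hmul (x : X) (hx : F x ≠ 0) : sumAbs φ t x = 0 := by
    rw [sumAbs_eq_zero_iff]
    intro g hg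
    have h1 := congrArg (fun F => F x) (congrArg φ (hann g hg))
    simp only [map_mul, map_zero, ContinuousMap.mul_apply, ContinuousMap.zero_apply] at h1
    exact (mul_eq_zero.1 h1).resolve_left (mt (hf0 x).1 hx)
  have hopen : IsOpen {x | sumAbs φ t x = 0} := by
    obtain ⟨r, hr⟩ := hb ⟨fun x => inverseLog (sumAbs φ t x),
      continuous_inverseLog_comp hG (sumAbs_nonneg φ t)⟩
      ⟨_, fun x => abs_inverseLog_le (sumAbs_nonneg φ t x)⟩
    have hfr : f * r = 0 := by
      apply hφ
      ext x
      by_cases hx : F x = 0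
      · simp [(hf0 x).2 hx]
      · simp [hr, hmul x hx, inverseLog_zero]
    obtain ⟨n, K, hK, hle⟩ := hdom r hfr
    exact isOpen_zeros_of_inverseLog_pow_le hG hK (sumAbs_nonneg φ t) n (by simpa [hr] using hle)
  suffices hcl : closure {x | F x ≠ 0} = {x | sumAbs φ t x = 0} by rwa [hcl]
  refine (closure_minimal hmul (isClosed_eq hG continuous_const)).antisymm fun x hx => ?_
  by_contra hxc
  obtain ⟨u, hu, hux, hu1⟩ := CompletelyRegularSpace.completely_regular x _ isClosed_closure hxc
  obtain ⟨r, hr⟩ := hb ⟨fun y => 1 - (u y : ℝ), by fun_prop⟩ ⟨1, fun y => by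
    have h0 := (u y).2.1
    have h1 := (u y).2.2
    rw [ContinuousMap.coe_mk, abs_le]
    constructor <;> linarith⟩
  have hfr : f * r = 0 := by
    apply hφ
    ext y
    by_cases hy : F y = 0
    · simp [(hf0 y).2 hy]
    · simp [hr, hu1 (subset_closure hy)]
  obtain ⟨n, K, -, hle⟩ := hdom r hfr
  have h1 := hle x
  rw [show sumAbs φ t x = 0 from hx, hr] at h1
  simp only [ContinuousMap.coe_mk, hux, Set.Icc.coe_zero, sub_zero, abs_one, one_pow,
    mul_zero] at h1
  linarith

theorem pseudocomplemented_of_basicallyDisconnected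
    (hφ : Function.Injective φ)
    (hb : ∀ F : C(X, ℝ), (∃ M, ∀ x, |F x| ≤ M) → ∃ r, φ r = F)
    (h : BasicallyDisconnected X) :
    Pseudocomplemented (qcop (inferInstance : TopologicalSpace (PrimeSpectrum R))) := by
  have := isReduced_of_injective_continuousMap hφ
  intro U hU
  obtain ⟨t, rfl⟩ := isCompact_isOpen_iff.1 hU.symm
  let A : Set X := closure {x | sumAbs φ t x ≠ 0}
  have hA : IsClopen A := ⟨isClosed_closure, h ⟨_, continuous_sumAbs φ t⟩⟩
  obtain ⟨e, he⟩ := hb ⟨Aᶜ.indicator 1, hA.compl.continuous_indicator continuous_one⟩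
    ⟨1, fun x => by by_cases hx : x ∈ A <;> simp [hx]⟩
  have hmem {g : R} (hg : g ∈ t) {x : X} (hx : φ g x ≠ 0) : x ∈ A :=
    subset_closure fun h0 => hx ((sumAbs_eq_zero_iff φ t x).1 h0 g hg)
  refine ⟨basicOpen e, ⟨(basicOpen e).isOpen, isCompact_basicOpen e⟩, ?_, fun W hW hUW p hp => ?_⟩
  · rw [← Set.disjoint_iff_inter_eq_empty, Set.disjoint_compl_left_iff_subset]
    intro p hp g hg
    have hge : g * e = 0 := by
      apply hφ
      ext x
      by_cases hx : φ g x = 0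
      · simp [hx]
      · simp [he, hmem hg hx]
    exact (p.2.mem_or_mem (hge ▸ p.asIdeal.zero_mem)).resolve_right hp
  · obtain ⟨_, ⟨r, rfl⟩, hpr, hrW⟩ :=
      isTopologicalBasis_basic_opens.exists_subset_of_mem_open hp hW.1
    have hr0 (g : R) (hg : g ∈ t) : g * r = 0 := by
      rw [← basicOpen_inter_eq_empty_iff, ← Set.subset_empty_iff, ← hUW]
      exact Set.inter_subset_inter (basicOpen_subset_compl_zeroLocus hg) hrW
    have hrA : A ⊆ {x | φ r x = 0} := by
      refine closure_minimal (fun x hx => ?_) (isClosed_eq (φ r).continuous continuous_const)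
      have hx : ¬ sumAbs φ t x = 0 := hx
      rw [sumAbs_eq_zero_iff] at hx
      push Not at hx
      obtain ⟨g, hg, hgx⟩ := hx
      have h1 := congrArg (fun F => F x) (congrArg φ (hr0 g hg))
      simp only [map_mul, map_zero, ContinuousMap.mul_apply, ContinuousMap.zero_apply] at h1
      exact (mul_eq_zero.1 h1).resolve_left hgx
    have hre : r * e = r := by
      apply hφ
      ext x
      by_cases hx : x ∈ A
      · simp [show φ r x = 0 from hrA hx]
      · simp [he, hx]
    exact fun hpe => hpr (hre ▸ p.asIdeal.mul_mem_left r hpe)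

/-- For a ring of continuous functions on `X` containing all bounded ones, the compact open
subsets of the spectrum are pseudocomplemented iff `X` is basically disconnected. -/
theorem pseudocomplemented_iff_basicallyDisconnected [CompletelyRegularSpace X]
    (hφ : Function.Injective φ)
    (hb : ∀ F : C(X, ℝ), (∃ M, ∀ x, |F x| ≤ M) → ∃ r, φ r = F) :
    Pseudocomplemented (qcop (inferInstance : TopologicalSpace (PrimeSpectrum R))) ↔
      BasicallyDisconnected X :=
  ⟨basicallyDisconnected_of_pseudocomplemented hφ hb,
    pseudocomplemented_of_basicallyDisconnected hφ hb⟩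

/-- Restriction of continuous functions along `X → StoneCech X`. -/
def stoneCechRestrict (X : Type*) [TopologicalSpace X] : C(StoneCech X, ℝ) →+* C(X, ℝ) :=
  (ContinuousMap.compRightAlgHom ℝ ℝ
    (⟨stoneCechUnit, continuous_stoneCechUnit⟩ : C(X, StoneCech X))).toRingHom

theorem stoneCechRestrict_apply (F : C(StoneCech X, ℝ)) (x : X) :
    stoneCechRestrict X F x = F (stoneCechUnit x) := rfl

theorem stoneCechRestrict_injective : Function.Injective (stoneCechRestrict X) := by
  intro F G hFG
  refine ContinuousMap.coe_injective
    (denseRange_stoneCechUnit.equalizer F.continuous G.continuous (funext fun x => ?_))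
  exact congrArg (fun H => H x) hFG

theorem exists_stoneCechRestrict_eq (F : C(X, ℝ)) (hF : ∃ M, ∀ x, |F x| ≤ M) :
    ∃ G, stoneCechRestrict X G = F := by
  obtain ⟨M, hM⟩ := hF
  have hc : Continuous fun x => (⟨F x, abs_le.1 (hM x)⟩ : Set.Icc (-M) M) := by fun_prop
  refine ⟨⟨fun y => (stoneCechExtend hc y).1,
    continuous_subtype_val.comp (continuous_stoneCechExtend hc)⟩, ?_⟩
  ext x
  rw [stoneCechRestrict_apply]
  exact congrArg Subtype.val (stoneCechExtend_stoneCechUnit hc x)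

end SpectrumOfFunctionRing

/-- For a completely regular Hausdorff space `T` with Stone-Čech
compactification `βT`: `Spec C(T)` is a PC-space iff `Spec C(βT)` is a PC-space;
equivalently, `qcop (Spec C(T))` is pseudocomplemented iff `qcop (Spec C*(T))` is
pseudocomplemented, where `C*(T)` is the ring of bounded continuous functions. -/
theorem statement_15 {T : Type*} [TopologicalSpace T] [CompletelyRegularSpace T]
    [T2Space T] :
    (IsPCSpace (specTop T) ↔ IsPCSpace (specTop (StoneCech T))) ∧
    (Pseudocomplemented (qcop (specTop T)) ↔
      Pseudocomplemented (qcop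
        (inferInstance :
          TopologicalSpace (PrimeSpectrum (BoundedContinuousFunction T ℝ))))) := by
  have hT := pseudocomplemented_iff_basicallyDisconnected (φ := RingHom.id C(T, ℝ))
    Function.injective_id fun F _ => ⟨F, rfl⟩
  have hβ := pseudocomplemented_iff_basicallyDisconnected (X := T) stoneCechRestrict_injective
    exists_stoneCechRestrict_eq
  have hb := pseudocomplemented_iff_basicallyDisconnected
    (φ := (BoundedContinuousFunction.toContinuousMapₐ ℝ :
      BoundedContinuousFunction T ℝ →ₐ[ℝ] C(T, ℝ)).toRingHom)
    (fun f g hfg => BoundedContinuousFunction.ext fun x => congrArg (fun H => H x) hfg)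
    fun F ⟨M, hM⟩ => ⟨BoundedContinuousFunction.ofNormedAddCommGroup F F.continuous M hM, rfl⟩
  exact ⟨hT.trans hβ.symm, hT.trans hb.symm⟩
end
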